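/- Let L be a finitely generated S-module. Then for almost all α: (i) proj dim_{S_α} L_α = proj dim_S L, and (ii) depth L_α = depth L (depth with respect to the maximal ideal of the local rings S_α and S). -/

import Mathlib

set_option maxHeartbeats 1000000
set_option synthInstance.maxHeartbeats 1000000

noncomputable section

namespace Spl

open MvPolynomial

/-- "Q(α) holds for almost all α ∈ K^m", i.e. away from a proper algebraic
subvariety of `K^m`. -/
def AlmostAll (K : Type) [Field K] (m : ℕ) (Q : (Fin m → K) → Prop) : Prop :=
  ∃ c : MvPolynomial (Fin m) K, c ≠ 0 ∧ ∀ α : Fin m → K, MvPolynomial.eval α c ≠ 0 → Q α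

variable (k K : Type) [Field k] [Field K] [Algebra k K]

/-- the field k(u) of rational functions in u = (u_1, ..., u_m) -/
abbrev kU (m : ℕ) := FractionRing (MvPolynomial (Fin m) k)

/-- the polynomial ring R = k(u)[X_1, ..., X_n] -/
abbrev Rg (m n : ℕ) := MvPolynomial (Fin n) (kU k m)

/-- the subfield k(α) ⊆ K generated by α = (α_1, ..., α_m) over k -/
abbrev kA {m : ℕ} (α : Fin m → K) := IntermediateField.adjoin k (Set.range α)

/-- the polynomial ring R_α = k(α)[X_1, ..., X_n] -/
abbrev Ra {m : ℕ} (n : ℕ) (α : Fin m → K) := MvPolynomial (Fin n) (kA k K α)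

/-- evaluation u ↦ α, from k[u] to k(α) -/
def evalα {m : ℕ} (α : Fin m → K) : MvPolynomial (Fin m) k →+* kA k K α :=
  (MvPolynomial.aeval fun i =>
    (⟨α i, IntermediateField.subset_adjoin k (Set.range α) ⟨i, rfl⟩⟩ : kA k K α)).toRingHom

/-- the inclusion k[u][X] → R = k(u)[X] -/
def toR (m n : ℕ) : MvPolynomial (Fin n) (MvPolynomial (Fin m) k) →+* Rg k m n :=
  MvPolynomial.map (algebraMap (MvPolynomial (Fin m) k) (kU k m))

/-- substitution u ↦ α, from k[u][X] to R_α = k(α)[X] -/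
def toRa {m : ℕ} (n : ℕ) (α : Fin m → K) :
    MvPolynomial (Fin n) (MvPolynomial (Fin m) k) →+* Ra k K n α :=
  MvPolynomial.map (evalα k K α)

/-- Krull's specialization I_α = { f(α,X) | f(u,X) ∈ I ∩ k[u,X] } of an ideal I ⊆ R
(as an ideal of R_α, i.e. the ideal spanned by the specialized elements). -/
def idealSpec {m : ℕ} (n : ℕ) (α : Fin m → K) (I : Ideal (Rg k m n)) :
    Ideal (Ra k K n α) :=
  Ideal.span (toRa k K n α '' { f | toR k m n f ∈ I })

/-- `ElemSpec k K n α f fα` : fα is the specialization of f ∈ R at α, i.e. writing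
f = p(u,X)/q(u) with q(α) ≠ 0 one has fα = p(α,X)/q(α). -/
def ElemSpec {m : ℕ} (n : ℕ) (α : Fin m → K) (f : Rg k m n) (fα : Ra k K n α) : Prop :=
  ∃ (p : MvPolynomial (Fin n) (MvPolynomial (Fin m) k)) (q : MvPolynomial (Fin m) k),
    evalα k K α q ≠ 0 ∧
    MvPolynomial.C (algebraMap (MvPolynomial (Fin m) k) (kU k m) q) * f = toR k m n p ∧
    MvPolynomial.C (evalα k K α q) * fα = toRa k K n α p

variable {k K}

/-- `LocElemSpec P ℘ a aα` : aα ∈ S_α = (R_α)_℘ is the specialization of a ∈ S = R_P,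
i.e. writing a = f/g with f, g ∈ R, g ∉ P, one has g_α ∉ ℘ and aα = f_α/g_α. -/
def LocElemSpec {m n : ℕ} {α : Fin m → K} (P : Ideal (Rg k m n)) [P.IsPrime]
    (℘ : Ideal (Ra k K n α)) [℘.IsPrime]
    {S : Type} [CommRing S] [Algebra (Rg k m n) S] [IsLocalization.AtPrime S P]
    {Sα : Type} [CommRing Sα] [Algebra (Ra k K n α) Sα] [IsLocalization.AtPrime Sα ℘]
    (a : S) (aα : Sα) : Prop :=
  ∃ (f g : Rg k m n) (fα gα : Ra k K n α) (hg : g ∈ P.primeCompl)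
    (hgα : gα ∈ ℘.primeCompl),
    ElemSpec k K n α f fα ∧ ElemSpec k K n α g gα ∧
    a = IsLocalization.mk' S f ⟨g, hg⟩ ∧
    aα = IsLocalization.mk' Sα fα ⟨gα, hgα⟩

/-- entrywise specialization of matrices, relative to an element-specialization
relation `E`. -/
def MatSpec {S T : Type} (E : S → T → Prop) {r s : ℕ}
    (A : Matrix (Fin r) (Fin s) S) (B : Matrix (Fin r) (Fin s) T) : Prop :=
  ∀ i j, E (A i j) (B i j)

/-- the cokernel of the linear map attached to a matrix A, i.e. the module
presented by A. -/
abbrev MatCoker {S : Type} [CommRing S] {r s : ℕ} (A : Matrix (Fin r) (Fin s) S) :=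
  (Fin r → S) ⧸ LinearMap.range A.mulVecLin

/-- a finite free presentation F_1 → F_0 → L → 0 of the module L, where the map
F_1 → F_0 is given by the matrix A and the map F_0 → L is π. -/
structure Present (S : Type) [CommRing S] (r s : ℕ) (L : Type) [AddCommGroup L]
    [Module S L] where
  A : Matrix (Fin r) (Fin s) S
  π : (Fin r → S) →ₗ[S] L
  surj : Function.Surjective π
  ker_eq : LinearMap.ker π = LinearMap.range A.mulVecLin

theorem comm_le {S : Type} [CommRing S] {r s r' s' : ℕ} {B : Matrix (Fin r) (Fin s) S}
    {C : Matrix (Fin r') (Fin s') S} {W : Matrix (Fin r') (Fin r) S}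
    {W1 : Matrix (Fin s') (Fin s) S} (h : W * B = C * W1) :
    LinearMap.range B.mulVecLin ≤ (LinearMap.range C.mulVecLin).comap W.mulVecLin := by
  rintro x ⟨y, rfl⟩
  exact ⟨W1.mulVecLin y, by
    simp only [Matrix.mulVecLin_apply, Matrix.mulVec_mulVec, h]⟩

/-- the map between the modules presented by B and C induced by the matrix W
(a specialization of a lift of a map between the presented modules). -/
def cokerMap {S : Type} [CommRing S] {r s r' s' : ℕ} {B : Matrix (Fin r) (Fin s) S}
    {C : Matrix (Fin r') (Fin s') S} (W : Matrix (Fin r') (Fin r) S)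
    (h : LinearMap.range B.mulVecLin ≤ (LinearMap.range C.mulVecLin).comap W.mulVecLin) :
    MatCoker B →ₗ[S] MatCoker C :=
  Submodule.mapQ _ _ W.mulVecLin h

/-- a lift of a homomorphism v : L → M to given finite free presentations of L and M:
a commutative diagram whose vertical maps are given by the matrices V1, V0. -/
structure MapLift {S : Type} [CommRing S] {rL sL rM sM : ℕ} {L M : Type}
    [AddCommGroup L] [Module S L] [AddCommGroup M] [Module S M]
    (pL : Present S rL sL L) (pM : Present S rM sM M) (v : L →ₗ[S] M) where
  V0 : Matrix (Fin rM) (Fin rL) S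
  V1 : Matrix (Fin sM) (Fin sL) S
  comm0 : pM.π ∘ₗ V0.mulVecLin = v ∘ₗ pL.π
  comm1 : V0 * pL.A = pM.A * V1

/-- Krull dimension of a module, dim L = dim S/Ann L. -/
def moduleDim (S : Type) [CommRing S] (L : Type) [AddCommGroup L] [Module S L] :
    WithBot ℕ∞ :=
  ringKrullDim (S ⧸ Module.annihilator S L)

/-- height of an ideal: the infimum of dim S_p over the primes p ⊇ I. -/
def idealHeight {S : Type} [CommRing S] (I : Ideal S) : WithBot ℕ∞ :=
  sInf { d | ∃ (p : Ideal S) (hp : p.IsPrime), I ≤ p ∧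
    d = ringKrullDim (Localization (@Ideal.primeCompl _ _ p hp)) }

/-- length of a module: the longest chain of submodules. -/
def moduleLength (S : Type) [CommRing S] (L : Type) [AddCommGroup L] [Module S L] :
    WithBot ℕ∞ :=
  Order.krullDim (Submodule S L)

/-- grade(𝔞, L) ≥ t : there is an L-regular sequence of length t in 𝔞. -/
def GradeGE {S : Type} [CommRing S] (𝔞 : Ideal S) (L : Type) [AddCommGroup L]
    [Module S L] (t : ℕ) : Prop :=
  ∃ rs : List S, rs.length = t ∧ (∀ x ∈ rs, x ∈ 𝔞) ∧ RingTheory.Sequence.IsRegular L rs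

/-- grade(𝔞, L) : the length of a maximal L-regular sequence in 𝔞. -/
def grade {S : Type} [CommRing S] (𝔞 : Ideal S) (L : Type) [AddCommGroup L]
    [Module S L] : ℕ∞ :=
  sSup { t : ℕ∞ | ∃ t' : ℕ, t = (t' : ℕ∞) ∧ GradeGE 𝔞 L t' }

/-- depth of a module over a local ring: grade(𝔪, L). -/
def depth (S : Type) [CommRing S] [IsLocalRing S] (L : Type) [AddCommGroup L]
    [Module S L] : ℕ∞ :=
  grade (IsLocalRing.maximalIdeal S) L

/-- proj dim L ≤ d : L admits a finite free resolution of length ≤ d, encoded as a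
(possibly infinite) free resolution ⋯ → F_1 → F_0 → L → 0 with F_j = 0 for j > d. -/
def ProjDimLE (S : Type) [CommRing S] (L : Type) [AddCommGroup L] [Module S L]
    (d : ℕ) : Prop :=
  ∃ (r : ℕ → ℕ) (A : ∀ j : ℕ, Matrix (Fin (r j)) (Fin (r (j + 1))) S)
    (π : (Fin (r 0) → S) →ₗ[S] L),
    Function.Surjective π ∧ LinearMap.ker π = LinearMap.range (A 0).mulVecLin ∧
    (∀ j : ℕ, LinearMap.ker (A j).mulVecLin = LinearMap.range (A (j + 1)).mulVecLin) ∧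
    ∀ j : ℕ, d < j → r j = 0

/-- projective dimension of a module, as an extended natural number. -/
def projDim (S : Type) [CommRing S] (L : Type) [AddCommGroup L] [Module S L] : ℕ∞ :=
  sInf { d : ℕ∞ | ∃ d' : ℕ, d = (d' : ℕ∞) ∧ ProjDimLE S L d' }

/-- the i-th local cohomology module H^i_𝔞(L) as a module. -/
abbrev localCoh {S : Type} [CommRing S] (𝔞 : Ideal S) (i : ℕ) (L : Type)
    [AddCommGroup L] [Module S L] : ModuleCat S :=
  (localCohomology 𝔞 i).obj (ModuleCat.of S L)

/-- the colon submodule (0 :_L 𝔞) = { x ∈ L | 𝔞 x = 0 }. -/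
def colonSubmodule {S : Type} [CommRing S] (𝔞 : Ideal S) (L : Type) [AddCommGroup L]
    [Module S L] : Submodule S L where
  carrier := { x | ∀ c ∈ 𝔞, c • x = 0 }
  add_mem' := by
    intro a b ha hb c hc
    rw [smul_add, ha c hc, hb c hc, add_zero]
  zero_mem' := by
    intro c _
    rw [smul_zero]
  smul_mem' := by
    intro s x hx c hc
    rw [smul_comm, hx c hc, smul_zero]

/-- a (partial) system of parameters: the d = dim L elements a_1, ..., a_d lie in the
maximal ideal and L/(a_1, ..., a_d)L has dimension ≤ 0. -/
def IsSOP (S : Type) [CommRing S] [IsLocalRing S] (L : Type) [AddCommGroup L]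
    [Module S L] {d : ℕ} (a : Fin d → S) : Prop :=
  (∀ i, a i ∈ IsLocalRing.maximalIdeal S) ∧
  moduleDim S L = (d : ℕ∞) ∧
  moduleDim S (L ⧸ (Ideal.span (Set.range a) • (⊤ : Submodule S L))) ≤ 0

/-- a standard system of parameters: (a_1, ..., a_d) H^i_𝔪(L/(a_1, ..., a_j)L) = 0
for all i + j < d. -/
def IsStandardSOP (S : Type) [CommRing S] [IsLocalRing S] (L : Type) [AddCommGroup L]
    [Module S L] {d : ℕ} (a : Fin d → S) : Prop :=
  IsSOP S L a ∧
  ∀ i j : ℕ, i + j < d →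
    Ideal.span (Set.range a) ≤ Module.annihilator S
      (localCoh (IsLocalRing.maximalIdeal S) i
        (L ⧸ (Ideal.span (a '' { x : Fin d | (x : ℕ) < j }) • (⊤ : Submodule S L))))

/-- a standard ideal for L: an 𝔪-primary ideal 𝔞 such that every system of
parameters of L contained in 𝔞 is standard. -/
def IsStandardIdeal (S : Type) [CommRing S] [IsLocalRing S] (L : Type) [AddCommGroup L]
    [Module S L] (𝔞 : Ideal S) : Prop :=
  𝔞.radical = IsLocalRing.maximalIdeal S ∧
  ∀ (d : ℕ) (a : Fin d → S), (∀ i, a i ∈ 𝔞) → IsSOP S L a → IsStandardSOP S L a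

section LocalDepth

open IsLocalRing TensorProduct Pointwise

/-- Reducing a module modulo two elements does not depend on their order. -/
def quotSMulTopComm {T : Type} [CommRing T] (N : Type) [AddCommGroup N] [Module T N] (x z : T) :
    QuotSMulTop z (QuotSMulTop x N) ≃ₗ[T] QuotSMulTop x (QuotSMulTop z N) :=
  (QuotSMulTop.equivTensorQuot z (QuotSMulTop x N)).trans <|
    (QuotSMulTop.quotSMulTopTensorEquivQuotSMulTop x (T ⧸ Ideal.span {z}) N).trans <|
      QuotSMulTop.congr x (QuotSMulTop.equivTensorQuot z N).symm

theorem gradeGE_zero_iff {T : Type} [CommRing T] (𝔞 : Ideal T) (N : Type) [AddCommGroup N]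
    [Module T N] : GradeGE 𝔞 N 0 ↔ Nontrivial N := by
  constructor
  · rintro ⟨rs, -, -, h⟩
    exact h.nontrivial
  · intro h
    exact ⟨[], rfl, by simp, RingTheory.Sequence.IsRegular.nil T N⟩

theorem gradeGE_succ_iff {T : Type} [CommRing T] (𝔞 : Ideal T) (N : Type) [AddCommGroup N]
    [Module T N] (t : ℕ) :
    GradeGE 𝔞 N (t + 1) ↔ ∃ x ∈ 𝔞, IsSMulRegular N x ∧ GradeGE 𝔞 (QuotSMulTop x N) t := by
  constructor
  · rintro ⟨rs, hl, hm, h⟩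
    cases rs with
    | nil => simp at hl
    | cons x rs =>
      rw [RingTheory.Sequence.isRegular_cons_iff] at h
      exact ⟨x, hm x (by simp), h.1, rs, by simpa using hl,
        fun y hy => hm y (by simp [hy]), h.2⟩
  · rintro ⟨x, hx, hreg, rs, hl, hm, h⟩
    refine ⟨x :: rs, by simp [hl], ?_, (RingTheory.Sequence.isRegular_cons_iff N x rs).2 ⟨hreg, h⟩⟩
    simpa using ⟨hx, hm⟩

theorem gradeGE_congr {T : Type} [CommRing T] (𝔞 : Ideal T) {N N' : Type} [AddCommGroup N]
    [Module T N] [AddCommGroup N'] [Module T N'] (e : N ≃ₗ[T] N') (t : ℕ) :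
    GradeGE 𝔞 N t ↔ GradeGE 𝔞 N' t := by
  simp only [GradeGE, e.isRegular_congr]

theorem GradeGE.nontrivial {T : Type} [CommRing T] {𝔞 : Ideal T} {N : Type} [AddCommGroup N]
    [Module T N] {t : ℕ} (h : GradeGE 𝔞 N t) : Nontrivial N := by
  obtain ⟨rs, -, -, h⟩ := h
  exact h.nontrivial

theorem mem_smul_top_iff_exists {T N : Type} [CommRing T] [AddCommGroup N] [Module T N]
    {x : T} {z : N} :
    z ∈ x • (⊤ : Submodule T N) ↔ ∃ w, z = x • w := by
  rw [Submodule.mem_smul_pointwise_iff_exists]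
  simp [eq_comm]

theorem isSMulRegular_quotSMulTop_swap {T N : Type} [CommRing T] [AddCommGroup N]
    [Module T N] {y z : T} (hy : IsSMulRegular N y)
    (hzy : IsSMulRegular (QuotSMulTop y N) z) :
    IsSMulRegular (QuotSMulTop z N) y := by
  rw [isSMulRegular_quotient_iff_mem_of_smul_mem] at hzy ⊢
  intro w hw
  obtain ⟨v, hv⟩ := mem_smul_top_iff_exists.1 hw
  obtain ⟨u, rfl⟩ := mem_smul_top_iff_exists.1 (hzy v (mem_smul_top_iff_exists.2 ⟨w, hv.symm⟩))
  exact mem_smul_top_iff_exists.2 ⟨u, hy (by simp only; rw [hv, smul_comm])⟩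

/-- The local module `N` has no nonzero element killed by the maximal ideal. -/
def SocleFree (T : Type) [CommRing T] [IsLocalRing T] (N : Type) [AddCommGroup N]
    [Module T N] : Prop :=
  ∀ z : N, (∀ a ∈ maximalIdeal T, a • z = 0) → z = 0

section

variable {T : Type} [CommRing T] [IsLocalRing T] {N N' : Type} [AddCommGroup N] [Module T N]
  [AddCommGroup N'] [Module T N']

theorem SocleFree.of_isSMulRegular {x : T} (hx : x ∈ maximalIdeal T) (h : IsSMulRegular N x) :
    SocleFree T N := fun z hz => h (by simpa using hz x hx)

theorem SocleFree.prod (h : SocleFree T N) (h' : SocleFree T N') : SocleFree T (N × N') := by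
  intro z hz
  ext
  · exact h _ fun a ha => congrArg Prod.fst (hz a ha)
  · exact h' _ fun a ha => congrArg Prod.snd (hz a ha)

theorem SocleFree.exists_isSMulRegular [IsNoetherianRing T] [Module.Finite T N]
    (h : SocleFree T N) : ∃ x ∈ maximalIdeal T, IsSMulRegular N x := by
  have : Subsingleton ((T ⧸ maximalIdeal T) →ₗ[T] N) := by
    refine subsingleton_of_forall_eq 0 fun f => LinearMap.ext fun y => ?_
    obtain ⟨y, rfl⟩ := Ideal.Quotient.mk_surjective y
    refine h _ fun a ha => ?_
    rw [← map_smul]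
    have : a • (Ideal.Quotient.mk (maximalIdeal T) y) = 0 := by
      rw [← Ideal.Quotient.mk_eq_mk, ← Submodule.Quotient.mk_smul, Submodule.Quotient.mk_eq_zero]
      exact Ideal.mul_mem_right _ _ ha
    rw [this, map_zero]
  obtain ⟨x, hx, hreg⟩ := IsSMulRegular.subsingleton_linearMap_iff.1 this
  exact ⟨x, by rwa [Ideal.annihilator_quotient] at hx, hreg⟩

theorem SocleFree.quotSMulTop_exchange {x y : T} (hx : IsSMulRegular N x) (hy : IsSMulRegular N y)
    (hym : y ∈ maximalIdeal T) (h : SocleFree T (QuotSMulTop y N)) :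
    SocleFree T (QuotSMulTop x N) := by
  intro z hz
  obtain ⟨z, rfl⟩ := Submodule.Quotient.mk_surjective _ z
  simp only [← Submodule.Quotient.mk_smul, Submodule.Quotient.mk_eq_zero,
    mem_smul_top_iff_exists] at hz ⊢
  obtain ⟨w, hw⟩ := hz y hym
  have hw' := h (Submodule.Quotient.mk w) (by
    intro a ha
    obtain ⟨v, hv⟩ := hz a ha
    rw [← Submodule.Quotient.mk_smul, Submodule.Quotient.mk_eq_zero, mem_smul_top_iff_exists]
    refine ⟨v, hx ?_⟩
    simp only
    rw [smul_comm x a w, ← hw, smul_comm a y z, hv, smul_comm])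
  rw [Submodule.Quotient.mk_eq_zero, mem_smul_top_iff_exists] at hw'
  obtain ⟨u, rfl⟩ := hw'
  exact ⟨u, hy (by simp only; rw [hw, smul_comm])⟩

end

theorem GradeGE.socleFree {T : Type} [CommRing T] [IsLocalRing T] {N : Type} [AddCommGroup N]
    [Module T N] {t : ℕ} (h : GradeGE (maximalIdeal T) N (t + 1)) : SocleFree T N := by
  obtain ⟨x, hx, hreg, -⟩ := (gradeGE_succ_iff _ _ _).1 h
  exact .of_isSMulRegular hx hreg

/-- **Rees' theorem**: dividing by a regular element lowers the depth by at most one. -/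
theorem GradeGE.quotSMulTop {T : Type} [CommRing T] [IsLocalRing T] [IsNoetherianRing T] {t : ℕ} :
    ∀ {N : Type} [AddCommGroup N] [Module T N] [Module.Finite T N] {x : T},
      x ∈ maximalIdeal T → IsSMulRegular N x → GradeGE (maximalIdeal T) N (t + 1) →
      GradeGE (maximalIdeal T) (QuotSMulTop x N) t := by
  induction t with
  | zero =>
    intro N _ _ _ x hx _ h
    have := h.nontrivial
    exact (gradeGE_zero_iff _ _).2 (nontrivial_quotSMulTop_of_mem_maximalIdeal N hx)
  | succ t ih =>
    intro N _ _ _ x hx hreg h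
    obtain ⟨y, hy, hyreg, h⟩ := (gradeGE_succ_iff _ _ _).1 h
    have hsy : SocleFree T (QuotSMulTop y N) := h.socleFree
    have hsx : SocleFree T (QuotSMulTop x N) := hsy.quotSMulTop_exchange hreg hyreg hy
    obtain ⟨z, hz, hzreg⟩ := (hsx.prod hsy).exists_isSMulRegular
    have hzx : IsSMulRegular (QuotSMulTop x N) z := fun a b hab => by
      simpa using @hzreg (a, 0) (b, 0) (by simpa using hab)
    have hzy : IsSMulRegular (QuotSMulTop y N) z := fun a b hab => by
      simpa using @hzreg (0, a) (0, b) (by simpa using hab)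
    have h1 : GradeGE (maximalIdeal T) (QuotSMulTop z N) (t + 1) :=
      (gradeGE_succ_iff _ _ _).2 ⟨y, hy, isSMulRegular_quotSMulTop_swap hyreg hzy,
        (gradeGE_congr _ (quotSMulTopComm N y z) t).1 (ih hz hzy h)⟩
    exact (gradeGE_succ_iff _ _ _).2 ⟨z, hz, hzx, (gradeGE_congr _ (quotSMulTopComm N x z) t).2
      (ih hx (isSMulRegular_quotSMulTop_swap hreg hzx) h1)⟩

theorem gradeGE_succ_iff_quotSMulTop {T : Type} [CommRing T] [IsLocalRing T] [IsNoetherianRing T]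
    {N : Type} [AddCommGroup N] [Module T N] [Module.Finite T N] {x : T}
    (hx : x ∈ maximalIdeal T) (hreg : IsSMulRegular N x) (t : ℕ) :
    GradeGE (maximalIdeal T) N (t + 1) ↔ GradeGE (maximalIdeal T) (QuotSMulTop x N) t :=
  ⟨GradeGE.quotSMulTop hx hreg, fun h => (gradeGE_succ_iff _ _ _).2 ⟨x, hx, hreg, h⟩⟩

end LocalDepth

section ProjectiveDimension

open CategoryTheory

theorem hasProjectiveDimensionLE_succ_iff {T : Type} [CommRing T] {N' F N : Type}
    [AddCommGroup N'] [Module T N'] [AddCommGroup F] [Module T F] [AddCommGroup N] [Module T N]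
    [Module.Projective T F] (i : N' →ₗ[T] F) (f : F →ₗ[T] N) (hi : Function.Injective i)
    (hif : Function.Exact i f) (hf : Function.Surjective f) (d : ℕ) :
    HasProjectiveDimensionLE (ModuleCat.of T N) (d + 1) ↔
      HasProjectiveDimensionLE (ModuleCat.of T N') d := by
  let C : ShortComplex (ModuleCat T) :=
    ShortComplex.mk (ModuleCat.ofHom i) (ModuleCat.ofHom f) (by
      ext x; exact hif.apply_apply_eq_zero x)
  have hC : C.ShortExact :=
    { exact := ModuleCat.shortComplex_exact _ hif
      mono_f := (ModuleCat.mono_iff_injective _).2 hi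
      epi_g := (ModuleCat.epi_iff_surjective _).2 hf }
  have : Projective C.X₂ := (IsProjective.iff_projective (R := T) F).1 inferInstance
  exact hC.hasProjectiveDimensionLT_X₃_iff d this

theorem hasProjectiveDimensionLE_zero_iff {T : Type} [CommRing T] {N : Type}
    [AddCommGroup N] [Module T N] :
    HasProjectiveDimensionLE (ModuleCat.of T N) 0 ↔ Module.Projective T N := by
  rw [← projective_iff_hasProjectiveDimensionLE_zero, IsProjective.iff_projective]

theorem hasProjectiveDimensionLE_congr {T : Type} [CommRing T] {N N' : Type}
    [AddCommGroup N] [Module T N] [AddCommGroup N'] [Module T N'] (e : N ≃ₗ[T] N') (d : ℕ) :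
    HasProjectiveDimensionLE (ModuleCat.of T N) d ↔
      HasProjectiveDimensionLE (ModuleCat.of T N') d :=
  ⟨fun _ => hasProjectiveDimensionLT_of_iso e.toModuleIso _,
    fun _ => hasProjectiveDimensionLT_of_iso e.symm.toModuleIso _⟩

theorem projDimLE_zero_iff {T : Type} [CommRing T] {N : Type} [AddCommGroup N] [Module T N] :
    ProjDimLE T N 0 ↔ ∃ r : ℕ, Nonempty ((Fin r → T) ≃ₗ[T] N) := by
  constructor
  · rintro ⟨r, A, π, hπ, hker, -, hr⟩
    have : IsEmpty (Fin (r (0 + 1))) := by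
      rw [hr (0 + 1) (by simp)]
      exact Fin.isEmpty
    refine ⟨r 0, ⟨LinearEquiv.ofBijective π ⟨?_, hπ⟩⟩⟩
    rw [← LinearMap.ker_eq_bot, hker, LinearMap.range_eq_bot]
    exact LinearMap.ext fun x => by rw [Subsingleton.elim x 0, map_zero, map_zero]
  · rintro ⟨r, ⟨e⟩⟩
    refine ⟨fun j => Nat.casesOn j r fun _ => 0, fun _ => 0, e.toLinearMap, e.surjective, ?_, ?_, ?_⟩
    · rw [LinearEquiv.ker, Matrix.mulVecLin_zero, LinearMap.range_zero]
    · intro j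
      exact Subsingleton.elim (α := Submodule T (Fin 0 → T)) _ _
    · rintro (_ | j) hj
      · simp at hj
      · rfl

theorem projDimLE_succ_iff {T : Type} [CommRing T] {N : Type} [AddCommGroup N] [Module T N]
    (d : ℕ) : ProjDimLE T N (d + 1) ↔ ∃ (r : ℕ) (π : (Fin r → T) →ₗ[T] N),
      Function.Surjective π ∧ ProjDimLE T (LinearMap.ker π) d := by
  constructor
  · rintro ⟨r, A, π, hπ, hker, hA, hr⟩
    refine ⟨r 0, π, hπ, fun j => r (j + 1), fun j => A (j + 1),
      (A 0).mulVecLin.codRestrict _ fun x => hker ▸ ⟨x, rfl⟩, ?_, ?_, fun j => hA (j + 1),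
      fun j hj => hr _ (by omega)⟩
    · rintro ⟨x, hx⟩
      rw [hker] at hx
      obtain ⟨y, rfl⟩ := hx
      exact ⟨y, rfl⟩
    · rw [LinearMap.ker_codRestrict]
      exact hA 0
  · rintro ⟨r₀, π₀, hπ₀, r, A, π, hπ, hker, hA, hr⟩
    let r' : ℕ → ℕ := fun j => Nat.casesOn j r₀ r
    let A' : ∀ j, Matrix (Fin (r' j)) (Fin (r' (j + 1))) T := fun j =>
      Nat.casesOn j (LinearMap.toMatrix' ((LinearMap.ker π₀).subtype ∘ₗ π)) A
    have hA0 : (A' 0).mulVecLin = (LinearMap.ker π₀).subtype ∘ₗ π :=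
      (Matrix.toLin'_apply' _).symm.trans (Matrix.toLin'_toMatrix' _)
    refine ⟨r', A', π₀, hπ₀, ?_, ?_, ?_⟩
    · rw [hA0, LinearMap.range_comp, LinearMap.range_eq_top.2 hπ, Submodule.map_top,
        Submodule.range_subtype]
    · rintro (_ | j)
      · rw [hA0, LinearMap.ker_comp_of_ker_eq_bot _ (Submodule.ker_subtype _)]
        exact hker
      · exact hA j
    · rintro (_ | j) hj
      · simp at hj
      · exact hr j (by omega)

theorem ProjDimLE.mono {T : Type} [CommRing T] {N : Type} [AddCommGroup N] [Module T N]
    {d e : ℕ} (hde : d ≤ e) (h : ProjDimLE T N d) : ProjDimLE T N e := by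
  obtain ⟨r, A, π, hπ, hker, hA, hr⟩ := h
  exact ⟨r, A, π, hπ, hker, hA, fun j hj => hr j (by omega)⟩

theorem projDimLE_iff {T : Type} [CommRing T] [IsLocalRing T] [IsNoetherianRing T] {d : ℕ} :
    ∀ {N : Type} [AddCommGroup N] [Module T N] [Module.Finite T N],
      ProjDimLE T N d ↔ HasProjectiveDimensionLE (ModuleCat.of T N) d := by
  induction d with
  | zero =>
    intro N _ _ _
    rw [projDimLE_zero_iff, hasProjectiveDimensionLE_zero_iff]
    constructor
    · rintro ⟨r, ⟨e⟩⟩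
      exact Module.Projective.of_equiv e
    · intro _
      have : Module.Free T N := Module.free_of_flat_of_isLocalRing
      exact ⟨_, ⟨(Module.finBasis T N).equivFun.symm⟩⟩
  | succ d ih =>
    intro N _ _ _
    rw [projDimLE_succ_iff]
    have key : ∀ (r : ℕ) (π : (Fin r → T) →ₗ[T] N), Function.Surjective π →
        (HasProjectiveDimensionLE (ModuleCat.of T N) (d + 1) ↔
          HasProjectiveDimensionLE (ModuleCat.of T (LinearMap.ker π)) d) := fun r π hπ =>
      hasProjectiveDimensionLE_succ_iff _ π (Submodule.subtype_injective _)
        (LinearMap.exact_subtype_ker_map π) hπ d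
    constructor
    · rintro ⟨r, π, hπ, h⟩
      exact (key r π hπ).2 (ih.1 h)
    · intro h
      obtain ⟨r, π, hπ⟩ := Module.Finite.exists_fin' T N
      exact ⟨r, π, hπ, ih.2 ((key r π hπ).1 h)⟩

end ProjectiveDimension

section GlobalDimension

open CategoryTheory TensorProduct

/-- every module over `T` has projective dimension at most `d` -/
def GlobalDimLE (T : Type) [CommRing T] (d : ℕ) : Prop :=
  ∀ N : ModuleCat.{0} T, HasProjectiveDimensionLE N d

theorem globalDimLE_of_field (F : Type) [Field F] : GlobalDimLE F 0 := fun N =>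
  (hasProjectiveDimensionLE_zero_iff (N := N)).2 inferInstance

theorem hasProjectiveDimensionLE_tensor_succ_iff {T T' : Type} [CommRing T] [CommRing T']
    [Algebra T T'] [Module.Flat T T'] {N' F N : Type}
    [AddCommGroup N'] [Module T N'] [AddCommGroup F] [Module T F] [AddCommGroup N] [Module T N]
    [Module.Projective T F] (i : N' →ₗ[T] F) (f : F →ₗ[T] N) (hi : Function.Injective i)
    (hif : Function.Exact i f) (hf : Function.Surjective f) (d : ℕ) :
    HasProjectiveDimensionLE (ModuleCat.of T' (T' ⊗[T] N)) (d + 1) ↔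
      HasProjectiveDimensionLE (ModuleCat.of T' (T' ⊗[T] N')) d :=
  hasProjectiveDimensionLE_succ_iff (i.baseChange T') (f.baseChange T')
    (Module.Flat.lTensor_preserves_injective_linearMap i hi)
    (Module.Flat.lTensor_exact T' hif) (LinearMap.lTensor_surjective T' hf) d

theorem hasProjectiveDimensionLE_tensor {T T' : Type} [CommRing T] [CommRing T'] [Algebra T T']
    [Module.Flat T T'] (d : ℕ) : ∀ (N : Type) [AddCommGroup N] [Module T N],
    HasProjectiveDimensionLE (ModuleCat.of T N) d →
      HasProjectiveDimensionLE (ModuleCat.of T' (T' ⊗[T] N)) d := by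
  induction d with
  | zero =>
    intro N _ _ h
    rw [hasProjectiveDimensionLE_zero_iff] at h ⊢
    infer_instance
  | succ d ih =>
    intro N _ _ h
    let f := Finsupp.linearCombination T (id : N → N)
    have hf : Function.Surjective f := Finsupp.linearCombination_id_surjective T N
    have hex : Function.Exact (LinearMap.ker f).subtype f := LinearMap.exact_subtype_ker_map f
    have h' := (hasProjectiveDimensionLE_succ_iff _ f (Submodule.subtype_injective _) hex hf d).1 h
    exact (hasProjectiveDimensionLE_tensor_succ_iff _ f (Submodule.subtype_injective _)
      hex hf d).2 (ih _ h')

section PolynomialSequence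

variable (T M : Type) [CommRing T] [AddCommGroup M] [Module T M] [Module (Polynomial T) M]
  [IsScalarTower T (Polynomial T) M]

/-- the endomorphism `p ⊗ m ↦ X p ⊗ m - p ⊗ X m` of `T[X] ⊗ M` -/
def polyShift : Polynomial T ⊗[T] M →ₗ[Polynomial T] Polynomial T ⊗[T] M :=
  (Polynomial.X : Polynomial T) • LinearMap.id -
    (Algebra.lsmul T T M (Polynomial.X : Polynomial T)).baseChange (Polynomial T)

/-- the multiplication map `T[X] ⊗ M → M` -/
def polyMul : Polynomial T ⊗[T] M →ₗ[Polynomial T] M :=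
  LinearMap.liftBaseChange (Polynomial T) LinearMap.id

variable {T M}

theorem polyShift_tmul (p : Polynomial T) (x : M) :
    polyShift T M (p ⊗ₜ x) = (Polynomial.X * p) ⊗ₜ x - p ⊗ₜ ((Polynomial.X : Polynomial T) • x) := by
  simp [polyShift, TensorProduct.smul_tmul']

theorem polyMul_tmul (p : Polynomial T) (x : M) : polyMul T M (p ⊗ₜ x) = p • x := by
  simp [polyMul]

theorem polyShift_injective : Function.Injective (polyShift T M) := by
  classical
  rw [injective_iff_map_eq_zero]
  intro z hz
  let e := TensorProduct.equivFinsuppOfBasisLeft (N := M) (Polynomial.basisMonomials T)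
  have he (p : Polynomial T) (x : M) (i : ℕ) : e (p ⊗ₜ x) i = p.coeff i • x := by
    simp [e, Polynomial.basisMonomials]; rfl
  have hrec (z : Polynomial T ⊗[T] M) (i : ℕ) :
      e (polyShift T M z) (i + 1) = e z i - (Polynomial.X : Polynomial T) • e z (i + 1) := by
    induction z with
    | zero => simp
    | add a b ha hb =>
      simp only [map_add, Finsupp.add_apply, ha, hb, smul_add]
      abel
    | tmul p x =>
      rw [polyShift_tmul, map_sub, Finsupp.sub_apply, he, he, he, he, Polynomial.coeff_X_mul,
        smul_comm (Polynomial.X : Polynomial T)]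
  have hz' (i : ℕ) : e z i = (Polynomial.X : Polynomial T) • e z (i + 1) := by
    have := hrec z i
    rwa [hz, map_zero, Finsupp.zero_apply, eq_comm, sub_eq_zero] at this
  obtain ⟨b, hb⟩ := (e z).support.bddAbove
  have hlarge (i : ℕ) (hi : b < i) : e z i = 0 := by
    by_contra hne
    exact absurd (hb (Finsupp.mem_support_iff.2 hne)) (by simpa using hi)
  have hall (j : ℕ) : ∀ i, b < i + j → e z i = 0 := by
    induction j with
    | zero => intro i hi; exact hlarge i (by simpa using hi)
    | succ j ih => intro i hi; rw [hz' i, ih (i + 1) (by omega), smul_zero]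
  apply e.injective
  rw [map_zero]
  exact Finsupp.ext fun i => hall (b + 1) i (by omega)

theorem polyMul_surjective : Function.Surjective (polyMul T M) := fun x =>
  ⟨1 ⊗ₜ x, by rw [polyMul_tmul, one_smul]⟩

theorem polyShift_polyMul_exact : Function.Exact (polyShift T M) (polyMul T M) := by
  intro z
  constructor
  · intro hz
    have key (z : Polynomial T ⊗[T] M) :
        z - 1 ⊗ₜ polyMul T M z ∈ LinearMap.range (polyShift T M) := by
      induction z with
      | zero => simp
      | add a b ha hb =>
        rw [map_add, tmul_add, add_sub_add_comm]
        exact add_mem ha hb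
      | tmul p x =>
        rw [polyMul_tmul]
        induction p using Polynomial.induction_on' generalizing x with
        | add p q hp hq =>
          rw [add_smul, tmul_add, add_tmul, add_sub_add_comm]
          exact add_mem (hp x) (hq x)
        | monomial i a =>
          induction i generalizing x with
          | zero =>
            have h1 : (Polynomial.monomial 0 a : Polynomial T) = a • 1 := by
              rw [Polynomial.monomial_zero_left, Polynomial.smul_eq_C_mul, mul_one]
            rw [h1, smul_assoc, one_smul, tmul_smul, smul_tmul', sub_self]
            exact zero_mem _
          | succ i ih =>
            have h1 : (Polynomial.monomial (i + 1) a : Polynomial T) =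
              Polynomial.X * Polynomial.monomial i a := by
                rw [Polynomial.X_mul_monomial]
            have := add_mem (ih ((Polynomial.X : Polynomial T) • x))
              (LinearMap.mem_range_self (polyShift T M) (Polynomial.monomial i a ⊗ₜ x))
            rw [polyShift_tmul, ← h1] at this
            convert this using 1
            rw [h1, mul_comm, mul_smul]
            abel
    have := key z
    rwa [hz, tmul_zero, sub_zero] at this
  · rintro ⟨w, rfl⟩
    induction w with
    | zero => simp
    | add a b ha hb => rw [map_add, map_add, ha, hb, add_zero]
    | tmul p x => rw [polyShift_tmul, map_sub, polyMul_tmul, polyMul_tmul, mul_comm, mul_smul, sub_self]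

end PolynomialSequence

theorem GlobalDimLE.polynomial {T : Type} [CommRing T] {d : ℕ} (h : GlobalDimLE T d) :
    GlobalDimLE (Polynomial T) (d + 1) := by
  intro M
  let : Module T M := Module.compHom M (algebraMap T (Polynomial T))
  have : IsScalarTower T (Polynomial T) M := IsScalarTower.of_algebraMap_smul fun _ _ => rfl
  let C : ShortComplex (ModuleCat.{0} (Polynomial T)) :=
    ShortComplex.mk (ModuleCat.ofHom (polyShift T M)) (ModuleCat.ofHom (polyMul T M)) (by
      ext1; exact LinearMap.ext fun x => polyShift_polyMul_exact.apply_apply_eq_zero x)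
  have hC : C.ShortExact :=
    { exact := ModuleCat.shortComplex_exact _ polyShift_polyMul_exact
      mono_f := (ModuleCat.mono_iff_injective _).2 polyShift_injective
      epi_g := (ModuleCat.epi_iff_surjective _).2 polyMul_surjective }
  have h1 : HasProjectiveDimensionLE (ModuleCat.of (Polynomial T) (Polynomial T ⊗[T] M)) d :=
    hasProjectiveDimensionLE_tensor d M (h _)
  have h2 : HasProjectiveDimensionLT C.X₁ (d + 1) := h1
  have h3 : HasProjectiveDimensionLT C.X₂ (d + 1 + 1) :=
    hasProjectiveDimensionLT_of_ge C.X₁ (d + 1) (d + 1 + 1) (by omega)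
  exact hC.hasProjectiveDimensionLT_X₃ (d + 1) h2 h3

attribute [local instance] RingHomInvPair.of_ringEquiv in
theorem GlobalDimLE.of_ringEquiv {T T' : Type} [CommRing T] [CommRing T'] (e : T ≃+* T') {d : ℕ}
    (h : GlobalDimLE T d) : GlobalDimLE T' d := by
  intro N
  let : Module T N := Module.compHom N e.toRingHom
  have : HasProjectiveDimensionLE (ModuleCat.of T N) d := h _
  let e' : (ModuleCat.of T N) ≃ₛₗ[(e : T →+* T')] N :=
    { AddEquiv.refl N with map_smul' := fun a x => rfl }
  exact ModuleCat.hasProjectiveDimensionLE_of_semiLinearEquiv e e' d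

theorem globalDimLE_mvPolynomial (F : Type) [Field F] (n : ℕ) :
    GlobalDimLE (MvPolynomial (Fin n) F) n := by
  induction n with
  | zero => exact (globalDimLE_of_field F).of_ringEquiv (isEmptyAlgEquiv F (Fin 0)).symm.toRingEquiv
  | succ n ih => exact ih.polynomial.of_ringEquiv (finSuccEquiv F n).symm.toRingEquiv

theorem GlobalDimLE.of_isLocalization {T T' : Type} [CommRing T] [CommRing T'] [Algebra T T']
    (W : Submonoid T) [IsLocalization W T'] {d : ℕ} (h : GlobalDimLE T d) : GlobalDimLE T' d := by
  intro N
  let : Module T N := Module.compHom N (algebraMap T T')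
  have : IsScalarTower T T' N := IsScalarTower.of_algebraMap_smul fun _ _ => rfl
  have : Module.Flat T T' := IsLocalization.flat T' W
  have h1 := hasProjectiveDimensionLE_tensor (T' := T') d N (h _)
  exact (hasProjectiveDimensionLE_congr ((IsLocalization.moduleTensorEquiv W T' T' N).symm ≪≫ₗ
    TensorProduct.lid T' N) d).1 h1

end GlobalDimension

section GenericTor

open TensorProduct

/-- tensoring with `κ` preserves injectivity of every submodule with quotient `Q`, i.e.
`Tor_1(Q, κ) = 0` -/
def TorVanish (A κ : Type) [CommRing A] [AddCommGroup κ] [Module A κ] (Q : Type) [AddCommGroup Q]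
    [Module A Q] : Prop :=
  ∀ (V : Type) [AddCommGroup V] [Module A V] (f : V →ₗ[A] Q), Function.Surjective f →
    Function.Injective ((LinearMap.ker f).subtype.rTensor κ)

variable {A κ : Type} [CommRing A] [AddCommGroup κ] [Module A κ]

theorem TorVanish.injective {U V Q : Type} [AddCommGroup U] [Module A U] [AddCommGroup V]
    [Module A V] [AddCommGroup Q] [Module A Q] (h : TorVanish A κ Q) {i : U →ₗ[A] V}
    {f : V →ₗ[A] Q} (hi : Function.Injective i) (hif : Function.Exact i f)
    (hf : Function.Surjective f) : Function.Injective (i.rTensor κ) := by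
  let e : U ≃ₗ[A] LinearMap.ker f :=
    LinearEquiv.ofBijective (i.codRestrict _ fun x => hif.apply_apply_eq_zero x) ⟨fun x y hxy =>
      hi (congrArg Subtype.val hxy), fun ⟨y, hy⟩ => by
        obtain ⟨x, rfl⟩ := (hif y).1 hy
        exact ⟨x, rfl⟩⟩
  have h1 : i = (LinearMap.ker f).subtype ∘ₗ e.toLinearMap := rfl
  rw [h1, LinearMap.rTensor_comp]
  exact (h V f hf).comp (e.rTensor κ).injective

theorem TorVanish.of_equiv {Q Q' : Type} [AddCommGroup Q] [Module A Q] [AddCommGroup Q']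
    [Module A Q'] (e : Q ≃ₗ[A] Q') (h : TorVanish A κ Q) : TorVanish A κ Q' := by
  intro V _ _ f hf
  refine h.injective (f := e.symm.toLinearMap ∘ₗ f) (Submodule.subtype_injective _) ?_
    (e.symm.surjective.comp hf)
  intro x
  simp

theorem TorVanish.of_exact {Q' Q Q'' : Type} [AddCommGroup Q'] [Module A Q'] [AddCommGroup Q]
    [Module A Q] [AddCommGroup Q''] [Module A Q''] {j : Q' →ₗ[A] Q} {g : Q →ₗ[A] Q''}
    (hj : Function.Injective j) (hjg : Function.Exact j g) (hg : Function.Surjective g)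
    (h' : TorVanish A κ Q') (h'' : TorVanish A κ Q'') : TorVanish A κ Q := by
  intro V _ _ f hf
  let W := LinearMap.ker (g ∘ₗ f)
  have hle : LinearMap.ker f ≤ W := fun x hx => by
    rw [LinearMap.mem_ker, LinearMap.comp_apply, LinearMap.mem_ker.1 hx, map_zero]
  let e : Q' ≃ₗ[A] LinearMap.ker g :=
    LinearEquiv.ofBijective (j.codRestrict _ fun x => hjg.apply_apply_eq_zero x) ⟨fun x y hxy =>
      hj (congrArg Subtype.val hxy), fun ⟨y, hy⟩ => by
        obtain ⟨x, rfl⟩ := (hjg y).1 hy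
        exact ⟨x, rfl⟩⟩
  have h1 : (LinearMap.ker f).subtype = W.subtype ∘ₗ Submodule.inclusion hle := rfl
  rw [h1, LinearMap.rTensor_comp]
  refine (h'' V (g ∘ₗ f) (hg.comp hf)).comp ((h'.of_equiv e).injective
    (f := (f ∘ₗ W.subtype).codRestrict _ fun x => x.2) (Submodule.inclusion_injective hle) ?_ ?_)
  · intro x
    constructor
    · intro hx
      exact ⟨⟨x.1, congrArg Subtype.val hx⟩, rfl⟩
    · rintro ⟨y, rfl⟩
      exact Subtype.ext y.2
  · rintro ⟨y, hy⟩
    obtain ⟨x, rfl⟩ := hf y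
    exact ⟨⟨x, hy⟩, rfl⟩

theorem TorVanish.of_projective (Q : Type) [AddCommGroup Q] [Module A Q] [Module.Projective A Q] :
    TorVanish A κ Q := by
  intro V _ _ f hf
  obtain ⟨s, hs⟩ := Module.projective_lifting_property f LinearMap.id hf
  let r : V →ₗ[A] LinearMap.ker f := (LinearMap.id - s ∘ₗ f).codRestrict _ fun x => by
    have := LinearMap.congr_fun hs (f x)
    simp only [LinearMap.comp_apply, LinearMap.id_apply] at this
    simp [this]
  have hr : r ∘ₗ (LinearMap.ker f).subtype = LinearMap.id :=
    LinearMap.ext fun x => Subtype.ext (by simp [r])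
  refine Function.LeftInverse.injective (g := r.rTensor κ) fun z => ?_
  rw [← LinearMap.rTensor_comp_apply, hr, LinearMap.rTensor_id_apply]

theorem TorVanish.of_smul_eq_zero (Q : Type) [AddCommGroup Q] [Module A Q] (c : A)
    (hc : ∀ q : Q, c • q = 0) (d : κ →ₗ[A] κ) (hd : ∀ x, d (c • x) = x) : TorVanish A κ Q := by
  intro V _ _ f hf
  let r : V →ₗ[A] LinearMap.ker f := (c • LinearMap.id).codRestrict _ fun x => by
    simp [hc]
  have hr : r ∘ₗ (LinearMap.ker f).subtype = c • LinearMap.id :=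
    LinearMap.ext fun x => Subtype.ext (by simp [r])
  refine Function.LeftInverse.injective (g := d.lTensor _ ∘ₗ r.rTensor κ) fun z => ?_
  rw [LinearMap.comp_apply, ← LinearMap.rTensor_comp_apply, hr]
  induction z with
  | zero => simp
  | add a b ha hb => rw [map_add, map_add, ha, hb]
  | tmul x y => simp [← tmul_smul, hd]

theorem TorVanish.of_chain {Q : Type} [AddCommGroup Q] [Module A Q] (F : ℕ → Submodule A Q)
    (hmono : Monotone F) (hF : ∀ q, ∃ j, q ∈ F j) (h : ∀ j, TorVanish A κ (F j)) :
    TorVanish A κ Q := by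
  intro V _ _ f hf
  rw [injective_iff_map_eq_zero]
  intro z hz
  obtain ⟨N, hNfg, hle, y, rfl⟩ := Submodule.exists_fg_le_eq_rTensor_inclusion z
  rw [← LinearMap.rTensor_comp_apply] at hz
  have h1 : (LinearMap.ker f).subtype ∘ₗ Submodule.inclusion hle = N.subtype := rfl
  rw [h1, ← map_zero (N.subtype.rTensor κ)] at hz
  obtain ⟨N', hfg', hN', hy⟩ := hNfg.exists_rTensor_fg_inclusion_eq hz
  obtain ⟨j, hj⟩ : ∃ j, N' ≤ (F j).comap f := by
    obtain ⟨s, rfl⟩ := hfg'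
    choose J hJ using hF
    refine ⟨s.sup fun v => J (f v), Submodule.span_le.2 fun v hv => ?_⟩
    exact hmono (Finset.le_sup (f := fun v => J (f v)) hv) (hJ (f v))
  have hker : LinearMap.ker f ≤ (F j).comap f := fun x hx => by
    rw [Submodule.mem_comap, LinearMap.mem_ker.1 hx]; exact zero_mem _
  have hinj : Function.Injective ((Submodule.inclusion hker).rTensor κ) :=
    (h j).injective (f := (f ∘ₗ ((F j).comap f).subtype).codRestrict _ fun x => x.2)
      (Submodule.inclusion_injective hker)
      (fun x => ⟨fun hx => ⟨⟨x.1, congrArg Subtype.val hx⟩, rfl⟩, by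
        rintro ⟨y, rfl⟩
        exact Subtype.ext y.2⟩)
      (by
        rintro ⟨y, hy⟩
        obtain ⟨x, rfl⟩ := hf y
        exact ⟨⟨x, hy⟩, rfl⟩)
  apply hinj
  rw [map_zero, ← LinearMap.rTensor_comp_apply]
  have h2 : Submodule.inclusion hker ∘ₗ Submodule.inclusion hle =
    Submodule.inclusion hj ∘ₗ Submodule.inclusion hN' := rfl
  rw [h2, LinearMap.rTensor_comp_apply, hy, map_zero, map_zero]

/-- every finite `B`-module has vanishing `Tor_1` over `A` against all fields over which a
suitable nonzero element of `A` becomes invertible -/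
def GenericTor (A B : Type) [CommRing A] [CommRing B] [Algebra A B] : Prop :=
  ∀ (Q : Type) [AddCommGroup Q] [Module A Q] [Module B Q] [IsScalarTower A B Q]
    [Module.Finite B Q], ∃ c : A, c ≠ 0 ∧
      ∀ (κ : Type) [Field κ] [Algebra A κ], algebraMap A κ c ≠ 0 → TorVanish A κ Q

theorem genericTor_self (A : Type) [CommRing A] [IsDomain A] [IsNoetherianRing A] :
    GenericTor A A := by
  intro Q _ m1 m2 ht _
  have : m1 = m2 := Module.ext' _ _ fun a q => by
    have := ht.smul_assoc a 1 q
    rw [smul_eq_mul, mul_one, one_smul] at this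
    exact this.symm
  subst this
  refine IsNoetherianRing.induction_on_isQuotientEquivQuotientPrime A
    (motive := fun N _ _ _ => ∃ c : A, c ≠ 0 ∧
      ∀ (κ : Type) [Field κ] [Algebra A κ], algebraMap A κ c ≠ 0 → TorVanish A κ N)
    inferInstance ?_ ?_ ?_
  · intro N _ _ _ _
    exact ⟨1, one_ne_zero, fun κ _ _ _ => .of_projective N⟩
  · intro N _ _ _ p e
    by_cases hp : p.asIdeal = ⊥
    · rw [hp] at e
      exact ⟨1, one_ne_zero, fun κ _ _ _ =>
        (TorVanish.of_projective A).of_equiv (e ≪≫ₗ Submodule.quotEquivOfEqBot (⊥ : Ideal A) rfl).symm⟩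
    · obtain ⟨c, hc, hc0⟩ := Submodule.exists_mem_ne_zero_of_ne_bot hp
      refine ⟨c, hc0, fun κ _ _ hκ => TorVanish.of_smul_eq_zero N c (fun q => e.injective ?_)
        (((algebraMap A κ c)⁻¹ • (LinearMap.id : κ →ₗ[κ] κ)).restrictScalars A) fun x => ?_⟩
      · rw [map_smul, map_zero]
        obtain ⟨x, hx⟩ := Ideal.Quotient.mk_surjective (e q)
        rw [← hx, ← Ideal.Quotient.mk_eq_mk, ← Submodule.Quotient.mk_smul,
          Submodule.Quotient.mk_eq_zero]
        exact Ideal.mul_mem_right _ _ hc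
      · simp [Algebra.smul_def, hκ]
  · rintro N₁ _ _ _ N₂ _ _ _ N₃ _ _ _ f g hf hg hfg ⟨c₁, hc₁, h₁⟩ ⟨c₂, hc₂, h₂⟩
    refine ⟨c₁ * c₂, mul_ne_zero hc₁ hc₂, fun κ _ _ hκ => ?_⟩
    rw [map_mul] at hκ
    exact TorVanish.of_exact hf hfg hg (h₁ κ (left_ne_zero_of_mul hκ))
      (h₂ κ (right_ne_zero_of_mul hκ))

end GenericTor

section GenericTorPolynomial

open Polynomial in
/-- the submodule of `Q` generated over `T` by `X^j q` for `j < i` and `q` in `Q₀` -/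
def powSpan {T Q : Type} [CommRing T] [AddCommGroup Q] [Module T Q] [Module T[X] Q]
    [IsScalarTower T T[X] Q] (Q₀ : Submodule T Q) : ℕ → Submodule T Q
  | 0 => ⊥
  | i + 1 => powSpan Q₀ i ⊔ Q₀.map (Algebra.lsmul T T Q ((X : T[X]) ^ i))

section

variable {T Q : Type} [CommRing T] [AddCommGroup Q] [Module T Q] [Module (Polynomial T) Q]
  [IsScalarTower T (Polynomial T) Q] (Q₀ : Submodule T Q)

theorem powSpan_mono : Monotone (powSpan Q₀) := monotone_nat_of_le_succ fun _ => le_sup_left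

theorem X_smul_mem_powSpan {i : ℕ} {q : Q} (hq : q ∈ powSpan Q₀ i) :
    (Polynomial.X : Polynomial T) • q ∈ powSpan Q₀ (i + 1) := by
  induction i generalizing q with
  | zero =>
    rw [powSpan, Submodule.mem_bot] at hq
    rw [hq, smul_zero]
    exact zero_mem _
  | succ i ih =>
    rw [powSpan, Submodule.mem_sup] at hq
    obtain ⟨y, hy, _, ⟨z, hz, rfl⟩, rfl⟩ := hq
    rw [smul_add]
    refine add_mem (powSpan_mono Q₀ (Nat.le_succ _) (ih hy)) (Submodule.mem_sup_right ⟨z, hz, ?_⟩)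
    simp [pow_succ']

theorem exists_mem_powSpan {s : Set Q} (hs : Submodule.span (Polynomial T) s = ⊤)
    (hs' : s ⊆ Q₀) (q : Q) : ∃ i, q ∈ powSpan Q₀ i := by
  have hq : q ∈ Submodule.span (Polynomial T) s := hs ▸ Submodule.mem_top
  induction hq using Submodule.span_induction with
  | mem x hx => exact ⟨1, Submodule.mem_sup_right ⟨x, hs' hx, by simp⟩⟩
  | zero => exact ⟨0, zero_mem _⟩
  | add x y _ _ hx hy =>
    obtain ⟨i, hi⟩ := hx
    obtain ⟨j, hj⟩ := hy
    exact ⟨max i j, add_mem (powSpan_mono Q₀ (le_max_left _ _) hi)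
      (powSpan_mono Q₀ (le_max_right _ _) hj)⟩
  | smul p x _ hx =>
    obtain ⟨i, hi⟩ := hx
    induction p using Polynomial.induction_on' with
    | add p r hp hr =>
      obtain ⟨j, hj⟩ := hp
      obtain ⟨l, hl⟩ := hr
      rw [add_smul]
      exact ⟨max j l, add_mem (powSpan_mono Q₀ (le_max_left _ _) hj)
        (powSpan_mono Q₀ (le_max_right _ _) hl)⟩
    | monomial e a =>
      have h1 : (Polynomial.monomial e a : Polynomial T) • x =
          a • ((Polynomial.X : Polynomial T) ^ e • x) := by
        rw [← Polynomial.C_mul_X_pow_eq_monomial, ← Polynomial.smul_eq_C_mul, smul_assoc]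
      rw [h1]
      suffices ∃ j, (Polynomial.X : Polynomial T) ^ e • x ∈ powSpan Q₀ j from
        this.imp fun j hj => Submodule.smul_mem _ a hj
      clear h1
      induction e with
      | zero => exact ⟨i, by simpa using hi⟩
      | succ e ih =>
        obtain ⟨j, hj⟩ := ih
        exact ⟨j + 1, by rw [pow_succ', mul_smul]; exact X_smul_mem_powSpan Q₀ hj⟩

/-- the map `q ↦ X^i q` from `Q₀` to the `i`-th graded piece of the filtration `powSpan` -/
def powSpanGraded (i : ℕ) :
    Q₀ →ₗ[T] powSpan Q₀ (i + 1) ⧸ (powSpan Q₀ i).submoduleOf (powSpan Q₀ (i + 1)) :=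
  Submodule.mkQ _ ∘ₗ
    ((Algebra.lsmul T T Q ((Polynomial.X : Polynomial T) ^ i) ∘ₗ Q₀.subtype).codRestrict
      (powSpan Q₀ (i + 1)) fun x => Submodule.mem_sup_right ⟨x, x.2, rfl⟩)

theorem powSpanGraded_surjective (i : ℕ) : Function.Surjective (powSpanGraded Q₀ i) := by
  intro x
  obtain ⟨⟨x, hx⟩, rfl⟩ := Submodule.mkQ_surjective _ x
  have hx' := hx
  rw [powSpan, Submodule.mem_sup] at hx'
  obtain ⟨y, hy, _, ⟨z, hz, rfl⟩, rfl⟩ := hx'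
  refine ⟨⟨z, hz⟩, (Submodule.Quotient.eq _).2 ?_⟩
  simpa [Submodule.submoduleOf] using hy

theorem mem_ker_powSpanGraded {i : ℕ} {q : Q₀} : q ∈ LinearMap.ker (powSpanGraded Q₀ i) ↔
    (Polynomial.X : Polynomial T) ^ i • (q : Q) ∈ powSpan Q₀ i := by
  rw [LinearMap.mem_ker, powSpanGraded, LinearMap.comp_apply, Submodule.mkQ_apply,
    Submodule.Quotient.mk_eq_zero]
  rfl

theorem ker_powSpanGraded_mono : Monotone fun i => LinearMap.ker (powSpanGraded Q₀ i) :=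
  monotone_nat_of_le_succ fun i q hq => by
    rw [mem_ker_powSpanGraded] at hq ⊢
    rw [pow_succ', mul_smul]
    exact X_smul_mem_powSpan Q₀ hq

end

theorem GenericTor.polynomial {A T : Type} [CommRing A] [IsDomain A] [CommRing T]
    [IsNoetherianRing T] [Algebra A T] (h : GenericTor A T) : GenericTor A (Polynomial T) := by
  intro Q _ _ _ _ _
  let _ : Module T Q := Module.compHom Q (algebraMap T (Polynomial T))
  have : IsScalarTower T (Polynomial T) Q := IsScalarTower.of_algebraMap_smul fun _ _ => rfl
  have : IsScalarTower A T Q := ⟨fun a b q => by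
    rw [← algebraMap_smul (Polynomial T) b q, ← algebraMap_smul (Polynomial T) (a • b) q,
      ← smul_assoc, Algebra.algebraMap_eq_smul_one,
      Algebra.algebraMap_eq_smul_one, smul_assoc a b (1 : Polynomial T)]⟩
  obtain ⟨s, hs⟩ := Module.Finite.fg_top (R := Polynomial T) (M := Q)
  let Q₀ : Submodule T Q := Submodule.span T s
  have : Module.Finite T Q₀ := Module.Finite.iff_fg.2 ⟨s, rfl⟩
  have : IsNoetherian T Q₀ := isNoetherian_of_isNoetherianRing_of_finite T Q₀
  obtain ⟨l, hl⟩ := monotone_stabilizes_iff_noetherian.2 this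
    ⟨_, ker_powSpanGraded_mono Q₀⟩
  have hc (i : ℕ) := h (Q₀ ⧸ LinearMap.ker (powSpanGraded Q₀ i))
  choose c hc0 hc using hc
  refine ⟨∏ i ∈ Finset.range (l + 1), c i, Finset.prod_ne_zero_iff.2 fun i _ => hc0 i, ?_⟩
  intro κ _ _ hκ
  rw [map_prod, Finset.prod_ne_zero_iff] at hκ
  have hN (i : ℕ) : TorVanish A κ (Q₀ ⧸ LinearMap.ker (powSpanGraded Q₀ i)) := by
    rcases le_total i l with hi | hi
    · exact hc i κ (hκ i (Finset.mem_range.2 (by omega)))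
    · have := hl i hi
      change LinearMap.ker (powSpanGraded Q₀ l) = LinearMap.ker (powSpanGraded Q₀ i) at this
      rw [← this]
      exact hc l κ (hκ l (Finset.mem_range.2 (by omega)))
  let F (i : ℕ) : Submodule A Q := (powSpan Q₀ i).restrictScalars A
  refine TorVanish.of_chain F (powSpan_mono Q₀)
    (exists_mem_powSpan Q₀ hs Submodule.subset_span) fun j => ?_
  induction j with
  | zero =>
    have : Subsingleton (F 0) := inferInstanceAs (Subsingleton (⊥ : Submodule T Q))
    exact TorVanish.of_projective _
  | succ j ih =>
    let j' : F j →ₗ[A] F (j + 1) := Submodule.inclusion (powSpan_mono Q₀ (Nat.le_succ j))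
    let N := (powSpan Q₀ j).submoduleOf (powSpan Q₀ (j + 1))
    let g : F (j + 1) →ₗ[A] (powSpan Q₀ (j + 1) ⧸ N) := N.mkQ.restrictScalars A
    refine TorVanish.of_exact (j := j') (g := g) (Submodule.inclusion_injective _) ?_
      N.mkQ_surjective ih ((hN j).of_equiv
        ((LinearMap.quotKerEquivOfSurjective _ (powSpanGraded_surjective Q₀ j)).restrictScalars A))
    intro x
    constructor
    · intro hx
      exact ⟨⟨x.1, (Submodule.Quotient.mk_eq_zero N).1 hx⟩, rfl⟩
    · rintro ⟨y, rfl⟩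
      exact (Submodule.Quotient.mk_eq_zero N).2 y.2

theorem GenericTor.of_algEquiv {A T T' : Type} [CommRing A] [CommRing T] [CommRing T']
    [Algebra A T] [Algebra A T'] (e : T ≃ₐ[A] T') (h : GenericTor A T) : GenericTor A T' := by
  intro Q _ _ _ _ _
  let _ : Module T Q := Module.compHom Q e.toRingEquiv.toRingHom
  have hsm (a : T) (q : Q) : a • q = e a • q := rfl
  have : IsScalarTower A T Q := ⟨fun a b q => by rw [hsm, hsm, map_smul, smul_assoc]⟩
  have : Module.Finite T Q := by
    obtain ⟨s, hs⟩ := Module.Finite.fg_top (R := T') (M := Q)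
    refine ⟨⟨s, eq_top_iff.2 fun q _ => ?_⟩⟩
    have hq : q ∈ Submodule.span T' s := hs ▸ Submodule.mem_top
    induction hq using Submodule.span_induction with
    | mem x hx => exact Submodule.subset_span hx
    | zero => exact zero_mem _
    | add x y _ _ hx hy => exact add_mem (hx trivial) (hy trivial)
    | smul a x _ hx =>
      rw [← e.apply_symm_apply a, ← hsm]
      exact Submodule.smul_mem _ _ (hx trivial)
  exact h Q

theorem genericTor_mvPolynomial (A : Type) [CommRing A] [IsDomain A] [IsNoetherianRing A]
    (n : ℕ) : GenericTor A (MvPolynomial (Fin n) A) := by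
  induction n with
  | zero => exact (genericTor_self A).of_algEquiv (isEmptyAlgEquiv A (Fin 0)).symm
  | succ n ih => exact ih.polynomial.of_algEquiv (finSuccEquiv A n).symm

end GenericTorPolynomial

section SpecializationPoint

open TensorProduct

attribute [local instance] MvPolynomial.algebraMvPolynomial

variable {A : Type} [CommRing A] {n : ℕ}

/-- `T` is the local ring of an associated point of the fibre of `P` over a field `κ`
in which the image of `c` is nonzero -/
def SpecPt (P : Ideal (MvPolynomial (Fin n) A)) (c : A) (T : Type) [CommRing T]
    [Algebra (MvPolynomial (Fin n) A) T] : Prop :=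
  ∃ (κ : Type) (_ : Field κ) (_ : Algebra A κ) (_ : Algebra (MvPolynomial (Fin n) κ) T)
    (℘ : Ideal (MvPolynomial (Fin n) κ)) (_ : ℘.IsPrime),
    algebraMap A κ c ≠ 0 ∧
    IsScalarTower (MvPolynomial (Fin n) A) (MvPolynomial (Fin n) κ) T ∧
    IsAssociatedPrime ℘ (MvPolynomial (Fin n) κ ⧸
      P.map (algebraMap (MvPolynomial (Fin n) A) (MvPolynomial (Fin n) κ))) ∧
    IsLocalization.AtPrime T ℘

variable {P : Ideal (MvPolynomial (Fin n) A)} {c : A}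

theorem SpecPt.of_dvd {c' : A} (hc : c' ∣ c) {T : Type} [CommRing T]
    [Algebra (MvPolynomial (Fin n) A) T] (h : SpecPt P c T) : SpecPt P c' T := by
  obtain ⟨κ, i1, i2, i3, ℘, i4, hκ, h⟩ := h
  exact ⟨κ, i1, i2, i3, ℘, i4, fun h0 => hκ (by
    obtain ⟨d, rfl⟩ := hc
    rw [map_mul, h0, zero_mul]), h⟩

theorem SpecPt.isLocalRing {T : Type} [CommRing T] [Algebra (MvPolynomial (Fin n) A) T]
    (h : SpecPt P c T) : IsLocalRing T := by
  obtain ⟨κ, i1, i2, i3, ℘, i4, -, -, -, h⟩ := h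
  exact IsLocalization.AtPrime.isLocalRing T ℘

theorem SpecPt.isNoetherianRing {T : Type} [CommRing T] [Algebra (MvPolynomial (Fin n) A) T]
    (h : SpecPt P c T) : IsNoetherianRing T := by
  obtain ⟨κ, i1, i2, i3, ℘, i4, -, -, -, h⟩ := h
  exact IsLocalization.isNoetherianRing ℘.primeCompl T inferInstance

theorem SpecPt.exists_socle {T : Type} [CommRing T] [Algebra (MvPolynomial (Fin n) A) T]
    [IsLocalRing T] (h : SpecPt P c T) :
    ∃ z : T ⊗[MvPolynomial (Fin n) A] (MvPolynomial (Fin n) A ⧸ P), z ≠ 0 ∧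
      ∀ a ∈ IsLocalRing.maximalIdeal T, a • z = 0 := by
  obtain ⟨κ, i1, i2, i3, ℘, i4, hκ, ht, hass, hloc⟩ := h
  obtain ⟨x, hx⟩ := (isAssociatedPrime_iff.1 hass).2
  obtain ⟨r, rfl⟩ := Ideal.Quotient.mk_surjective x
  set J := P.map (algebraMap (MvPolynomial (Fin n) A) (MvPolynomial (Fin n) κ)) with hJ
  have hmem (a : MvPolynomial (Fin n) κ) : a ∈ ℘ ↔ a * r ∈ J := by
    rw [hx, Submodule.mem_colon_singleton, Submodule.mem_bot, ← Ideal.Quotient.eq_zero_iff_mem,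
      map_mul]
    rfl
  have hJT : J.map (algebraMap (MvPolynomial (Fin n) κ) T) =
      P.map (algebraMap (MvPolynomial (Fin n) A) T) := by
    rw [hJ, Ideal.map_map, ← IsScalarTower.algebraMap_eq]
  let e := Algebra.TensorProduct.quotIdealMapEquivTensorQuot T P
  have hne : Ideal.Quotient.mk (P.map (algebraMap (MvPolynomial (Fin n) A) T))
      (algebraMap (MvPolynomial (Fin n) κ) T r) ≠ 0 := by
    rw [Ne, Ideal.Quotient.eq_zero_iff_mem, ← hJT,
      IsLocalization.algebraMap_mem_map_algebraMap_iff ℘.primeCompl]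
    rintro ⟨s, hs, hsr⟩
    exact hs ((hmem s).2 hsr)
  refine ⟨e (Ideal.Quotient.mk _ (algebraMap (MvPolynomial (Fin n) κ) T r)), ?_, ?_⟩
  · rw [Ne, EmbeddingLike.map_eq_zero_iff]
    exact hne
  · intro a ha
    rw [← map_smul, EmbeddingLike.map_eq_zero_iff, Algebra.smul_def, Ideal.Quotient.algebraMap_eq,
      ← map_mul, Ideal.Quotient.eq_zero_iff_mem, ← hJT]
    rw [← IsLocalization.AtPrime.map_eq_maximalIdeal ℘ T] at ha
    have : Ideal.span {algebraMap (MvPolynomial (Fin n) κ) T r} *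
        ℘.map (algebraMap (MvPolynomial (Fin n) κ) T) ≤
        J.map (algebraMap (MvPolynomial (Fin n) κ) T) := by
      rw [← Set.image_singleton, ← Ideal.map_span, ← Ideal.map_mul]
      refine Ideal.map_mono (Ideal.mul_le.2 fun y hy b hb => ?_)
      obtain ⟨w, rfl⟩ := Ideal.mem_span_singleton'.1 hy
      rw [mul_assoc, mul_comm r]
      exact Ideal.mul_mem_left _ _ ((hmem b).1 hb)
    rw [mul_comm]
    exact this (Ideal.mul_mem_mul (Ideal.mem_span_singleton_self _) ha)

theorem SpecPt.algebraMap_mem {T : Type} [CommRing T] [Algebra (MvPolynomial (Fin n) A) T]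
    [IsLocalRing T] (h : SpecPt P c T) {b : MvPolynomial (Fin n) A} (hb : b ∈ P) :
    algebraMap (MvPolynomial (Fin n) A) T b ∈ IsLocalRing.maximalIdeal T := by
  obtain ⟨z, hz, -⟩ := h.exists_socle
  rw [IsLocalRing.mem_maximalIdeal, mem_nonunits_iff]
  intro hu
  have hbz : algebraMap (MvPolynomial (Fin n) A) T b • z = 0 := by
    rw [algebraMap_smul]
    clear hz
    induction z with
    | zero => simp
    | add x y hx hy => rw [smul_add, hx, hy, add_zero]
    | tmul t q =>
      obtain ⟨q, rfl⟩ := Ideal.Quotient.mk_surjective q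
      rw [← tmul_smul, show b • Ideal.Quotient.mk P q = Ideal.Quotient.mk P (b * q) from rfl,
        Ideal.Quotient.eq_zero_iff_mem.2 (Ideal.mul_mem_right _ _ hb), tmul_zero]
  exact hz ((hu.smul_eq_zero).1 hbz)

/-- `Φ T` holds for all associated points of the fibres of `P` over the points of a nonempty
principal open subset of the base -/
def Generically (P : Ideal (MvPolynomial (Fin n) A))
    (Φ : ∀ (T : Type) [CommRing T] [Algebra (MvPolynomial (Fin n) A) T] [IsLocalRing T]
      [IsNoetherianRing T], Prop) : Prop :=
  ∃ c : A, c ≠ 0 ∧ ∀ (T : Type) [CommRing T] [Algebra (MvPolynomial (Fin n) A) T] [IsLocalRing T]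
    [IsNoetherianRing T], SpecPt P c T → Φ T

theorem generically_injective [IsDomain A] [IsNoetherianRing A] (P : Ideal (MvPolynomial (Fin n) A))
    {M N : Type} [AddCommGroup M] [Module (MvPolynomial (Fin n) A) M] [AddCommGroup N]
    [Module (MvPolynomial (Fin n) A) N] [Module.Finite (MvPolynomial (Fin n) A) N]
    (f : M →ₗ[MvPolynomial (Fin n) A] N) (hf : Function.Injective f) :
    Generically P fun T => Function.Injective (f.lTensor T) := by
  let _ : Module A M := Module.compHom M (algebraMap A (MvPolynomial (Fin n) A))
  have : IsScalarTower A (MvPolynomial (Fin n) A) M := IsScalarTower.of_algebraMap_smul fun _ _ => rfl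
  let _ : Module A N := Module.compHom N (algebraMap A (MvPolynomial (Fin n) A))
  have : IsScalarTower A (MvPolynomial (Fin n) A) N := IsScalarTower.of_algebraMap_smul fun _ _ => rfl
  obtain ⟨c, hc0, hc⟩ := genericTor_mvPolynomial A n (N ⧸ LinearMap.range f)
  refine ⟨c, hc0, ?_⟩
  rintro T _ _ _ _ ⟨κ, i1, i2, i3, ℘, i4, hκ, ht, -, hloc⟩
  have h1 : Function.Injective ((f.restrictScalars A).lTensor κ) := by
    rw [LinearMap.lTensor_inj_iff_rTensor_inj]
    exact (hc κ hκ).injective (f := (LinearMap.range f).mkQ.restrictScalars A) hf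
      (LinearMap.exact_map_mkQ_range f) (Submodule.mkQ_surjective _)
  let eM := Algebra.IsPushout.cancelBaseChange A κ (MvPolynomial (Fin n) A)
    (MvPolynomial (Fin n) κ) M
  let eN := Algebra.IsPushout.cancelBaseChange A κ (MvPolynomial (Fin n) A)
    (MvPolynomial (Fin n) κ) N
  have hsq (z : κ ⊗[A] M) : eN.symm ((f.restrictScalars A).lTensor κ z) =
      f.baseChange (MvPolynomial (Fin n) κ) (eM.symm z) := by
    induction z with
    | zero => simp
    | add a b ha hb => simp only [map_add, ha, hb]
    | tmul s x =>
      have h2 : s ⊗ₜ[A] x = s • ((1 : κ) ⊗ₜ[A] x) := by rw [smul_tmul', smul_eq_mul, mul_one]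
      have h3 : s ⊗ₜ[A] f x = s • ((1 : κ) ⊗ₜ[A] f x) := by rw [smul_tmul', smul_eq_mul, mul_one]
      have hM : eM.symm (1 ⊗ₜ x) = 1 ⊗ₜ x := by
        rw [LinearEquiv.symm_apply_eq, Algebra.IsPushout.cancelBaseChange_tmul]
      have hN : eN.symm (1 ⊗ₜ f x) = 1 ⊗ₜ f x := by
        rw [LinearEquiv.symm_apply_eq, Algebra.IsPushout.cancelBaseChange_tmul]
      rw [LinearMap.lTensor_tmul, LinearMap.restrictScalars_apply, h2, h3, map_smul, map_smul,
        hM, hN, LinearMap.map_smul_of_tower, LinearMap.baseChange_tmul]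
  have h4 : Function.Injective (f.baseChange (MvPolynomial (Fin n) κ)) := by
    have : ⇑(f.baseChange (MvPolynomial (Fin n) κ)) =
        eN.symm ∘ ((f.restrictScalars A).lTensor κ) ∘ eM := by
      funext z
      simp only [Function.comp_apply, hsq, LinearEquiv.symm_apply_apply]
    rw [this]
    exact eN.symm.injective.comp (h1.comp eM.injective)
  have : Module.Flat (MvPolynomial (Fin n) κ) T := IsLocalization.flat T ℘.primeCompl
  have h5 := Module.Flat.lTensor_preserves_injective_linearMap (M := T) _ h4
  let cM := AlgebraTensorModule.cancelBaseChange (MvPolynomial (Fin n) A) (MvPolynomial (Fin n) κ)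
    T T M
  let cN := AlgebraTensorModule.cancelBaseChange (MvPolynomial (Fin n) A) (MvPolynomial (Fin n) κ)
    T T N
  have hsq' (z) : cN ((f.baseChange (MvPolynomial (Fin n) κ)).lTensor T z) = f.lTensor T (cM z) := by
    induction z with
    | zero => simp
    | add a b ha hb => simp only [map_add, ha, hb]
    | tmul s x =>
      induction x with
      | zero => simp
      | add a b ha hb => simp only [tmul_add, map_add, ha, hb]
      | tmul p x => simp [cM, cN]
  have h6 : ⇑(f.lTensor T) =
      cN ∘ ((f.baseChange (MvPolynomial (Fin n) κ)).lTensor T) ∘ cM.symm := by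
    funext z
    simp only [Function.comp_apply, hsq', LinearEquiv.apply_symm_apply]
  rw [h6]
  exact cN.injective.comp (h5.comp cM.symm.injective)

theorem Generically.and [IsDomain A]
    {Φ Ψ : ∀ (T : Type) [CommRing T] [Algebra (MvPolynomial (Fin n) A) T] [IsLocalRing T]
      [IsNoetherianRing T], Prop} (h : Generically P Φ) (h' : Generically P Ψ) :
    Generically P fun T => Φ T ∧ Ψ T := by
  obtain ⟨c, hc, h⟩ := h
  obtain ⟨c', hc', h'⟩ := h'
  exact ⟨c * c', mul_ne_zero hc hc', fun T _ _ _ _ hT =>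
    ⟨h T (hT.of_dvd (dvd_mul_right c c')), h' T (hT.of_dvd (dvd_mul_left c' c))⟩⟩

/-- the point condition may be used when weakening a generic property -/
theorem Generically.imp
    {Φ Ψ : ∀ (T : Type) [CommRing T] [Algebra (MvPolynomial (Fin n) A) T] [IsLocalRing T]
      [IsNoetherianRing T], Prop} (h : Generically P Φ)
    (himp : ∀ (T : Type) [CommRing T] [Algebra (MvPolynomial (Fin n) A) T] [IsLocalRing T]
      [IsNoetherianRing T] (c : A), SpecPt P c T → Φ T → Ψ T) : Generically P Ψ := by
  obtain ⟨c, hc, h⟩ := h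
  exact ⟨c, hc, fun T _ _ _ _ hT => himp T c hT (h T hT)⟩

theorem generically_isUnit [IsDomain A] [IsNoetherianRing A] [P.IsPrime]
    {g : MvPolynomial (Fin n) A} (hg : g ∉ P) :
    Generically P fun T => IsUnit (algebraMap (MvPolynomial (Fin n) A) T g) := by
  refine (generically_injective P
    (LinearMap.lsmul (MvPolynomial (Fin n) A) (MvPolynomial (Fin n) A ⧸ P) g) ?_).imp ?_
  · rw [injective_iff_map_eq_zero]
    intro x hx
    obtain ⟨x, rfl⟩ := Ideal.Quotient.mk_surjective x
    rw [LinearMap.lsmul_apply,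
      show g • Ideal.Quotient.mk P x = Ideal.Quotient.mk P (g * x) from rfl,
      Ideal.Quotient.eq_zero_iff_mem] at hx
    exact Ideal.Quotient.eq_zero_iff_mem.2 ((Ideal.IsPrime.mem_or_mem ‹_› hx).resolve_left hg)
  · intro T _ _ _ _ c hT hinj
    obtain ⟨z, hz, hmz⟩ := hT.exists_socle
    by_contra hu
    refine hz (hinj ?_)
    have : (LinearMap.lsmul (MvPolynomial (Fin n) A) (MvPolynomial (Fin n) A ⧸ P) g).lTensor T z
        = algebraMap (MvPolynomial (Fin n) A) T g • z := by
      clear hz hmz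
      induction z with
      | zero => simp
      | add a b ha hb => rw [map_add, ha, hb, smul_add]
      | tmul t x => simp
    rw [this, map_zero]
    exact hmz _ ((IsLocalRing.mem_maximalIdeal _).2 hu)

end SpecializationPoint

section GenericDepth

open TensorProduct IsLocalRing Pointwise

theorem exists_notMem_smul_eq_zero {B S M : Type} [CommRing B] [CommRing S] [Algebra B S]
    (P : Ideal B) [P.IsPrime] [IsLocalization.AtPrime S P] [AddCommGroup M] [Module B M]
    {N : Submodule B M} (hN : N.FG) (h : ∀ x ∈ N, (1 : S) ⊗ₜ[B] x = 0) :
    ∃ g ∉ P, ∀ x ∈ N, g • x = 0 := by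
  classical
  obtain ⟨s, rfl⟩ := hN
  have h' (x : M) (hx : x ∈ s) : ∃ g : P.primeCompl, g • x = 0 :=
    (IsLocalizedModule.eq_zero_iff P.primeCompl (TensorProduct.mk B S M 1)).1
      (h x (Submodule.subset_span hx))
  choose! g hg using h'
  refine ⟨((∏ x ∈ s, g x : P.primeCompl) : B), (∏ x ∈ s, g x).2, fun x hx => ?_⟩
  induction hx using Submodule.span_induction with
  | mem x hx =>
    rw [← Finset.prod_erase_mul s g hx, Submonoid.coe_mul, mul_smul]
    have := hg x hx
    rw [Submonoid.smul_def] at this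
    rw [this, smul_zero]
  | zero => rw [smul_zero]
  | add x y _ _ hx hy => rw [smul_add, hx, hy, add_zero]
  | smul a x _ hx => rw [smul_comm, hx, smul_zero]

theorem lTensor_lsmul {B T M : Type} [CommRing B] [CommRing T] [Algebra B T] [AddCommGroup M]
    [Module B M] (b : B) (z : T ⊗[B] M) :
    (LinearMap.lsmul B M b).lTensor T z = algebraMap B T b • z := by
  induction z with
  | zero => simp
  | add x y hx hy => rw [map_add, hx, hy, smul_add]
  | tmul t x => simp

theorem isSMulRegular_tensor_iff {B T M : Type} [CommRing B] [CommRing T] [Algebra B T]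
    [AddCommGroup M] [Module B M] (b : B) : IsSMulRegular (T ⊗[B] M) (algebraMap B T b) ↔
      Function.Injective ((LinearMap.lsmul B M b).lTensor T) := by
  have : ⇑((LinearMap.lsmul B M b).lTensor T) = fun z => algebraMap B T b • z :=
    funext fun z => lTensor_lsmul b z
  rw [this]
  rfl

theorem eq_zero_of_isUnit_smul {B T M : Type} [CommRing B] [CommRing T] [Algebra B T]
    [AddCommGroup M] [Module B M] {g : B} (hg : IsUnit (algebraMap B T g))
    (h : ∀ x : M, g • x = 0) : Subsingleton (T ⊗[B] M) := by
  refine subsingleton_of_forall_eq 0 fun z => hg.smul_eq_zero.1 ?_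
  rw [← lTensor_lsmul, show LinearMap.lsmul B M g = 0 from LinearMap.ext h,
    LinearMap.lTensor_zero, LinearMap.zero_apply]

theorem nontrivial_quotSMulTop_iff {T N : Type} [CommRing T] [IsLocalRing T] [AddCommGroup N]
    [Module T N] [Module.Finite T N] {x : T} (hx : x ∈ maximalIdeal T) :
    Nontrivial (QuotSMulTop x N) ↔ Nontrivial N := by
  constructor
  · intro h
    exact (Submodule.mkQ_surjective (x • (⊤ : Submodule T N))).nontrivial
  · intro h
    by_contra hn
    rw [not_nontrivial_iff_subsingleton] at hn
    have h1 : (⊤ : Submodule T N) ≤ maximalIdeal T • ⊤ := by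
      rintro z -
      obtain ⟨w, rfl⟩ := mem_smul_top_iff_exists.1
        ((Submodule.Quotient.mk_eq_zero _).1 (Subsingleton.elim (α := QuotSMulTop x N)
          (Submodule.Quotient.mk z) 0))
      exact Submodule.smul_mem_smul hx trivial
    exact top_ne_bot (Submodule.eq_bot_of_le_smul_of_le_jacobson_bot _ _ Module.Finite.fg_top h1
      (maximalIdeal_le_jacobson _))

theorem exact_subtype_ker_rangeRestrict {B M N : Type} [CommRing B] [AddCommGroup M] [Module B M]
    [AddCommGroup N] [Module B N] (f : M →ₗ[B] N) :
    Function.Exact (LinearMap.ker f).subtype f.rangeRestrict :=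
  fun x => ⟨fun hx => ⟨⟨x, congrArg Subtype.val hx⟩, rfl⟩, by
    rintro ⟨y, rfl⟩
    exact Subtype.ext y.2⟩

variable {A : Type} [CommRing A] [IsDomain A] [IsNoetherianRing A] {n : ℕ}
  {P : Ideal (MvPolynomial (Fin n) A)} [P.IsPrime]
  (S : Type) [CommRing S] [Algebra (MvPolynomial (Fin n) A) S] [IsLocalization.AtPrime S P]

include S in
theorem generically_injective_of_localization {M N : Type} [AddCommGroup M]
    [Module (MvPolynomial (Fin n) A) M] [Module.Finite (MvPolynomial (Fin n) A) M]
    [AddCommGroup N] [Module (MvPolynomial (Fin n) A) N]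
    [Module.Finite (MvPolynomial (Fin n) A) N]
    (f : M →ₗ[MvPolynomial (Fin n) A] N) (hf : Function.Injective (f.lTensor S)) :
    Generically P fun T => Function.Injective (f.lTensor T) := by
  obtain ⟨g, hg, hgx⟩ := exists_notMem_smul_eq_zero (S := S) P
    (N := LinearMap.ker f) (IsNoetherian.noetherian _) fun x hx => hf (by
      rw [LinearMap.lTensor_tmul, LinearMap.mem_ker.1 hx, tmul_zero, map_zero])
  refine ((generically_injective P (LinearMap.range f).subtype (Submodule.subtype_injective _)).and
    (generically_isUnit hg)).imp fun T _ _ _ _ c _ ⟨hinj, hu⟩ => ?_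
  have h1 : f = (LinearMap.range f).subtype ∘ₗ f.rangeRestrict := rfl
  rw [h1, LinearMap.lTensor_comp]
  refine hinj.comp ?_
  have h2 := lTensor_exact T (f := (LinearMap.ker f).subtype) (g := f.rangeRestrict)
    (exact_subtype_ker_rangeRestrict f) f.surjective_rangeRestrict
  have : Subsingleton (T ⊗[MvPolynomial (Fin n) A] LinearMap.ker f) :=
    eq_zero_of_isUnit_smul hu fun x => Subtype.ext (hgx x x.2)
  rw [injective_iff_map_eq_zero]
  intro z hz
  obtain ⟨w, rfl⟩ := (h2 z).1 hz
  rw [Subsingleton.elim w 0, map_zero]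

include S in
theorem generically_subsingleton_of_localization {M : Type} [AddCommGroup M]
    [Module (MvPolynomial (Fin n) A) M] [Module.Finite (MvPolynomial (Fin n) A) M]
    (h : Subsingleton (S ⊗[MvPolynomial (Fin n) A] M)) :
    Generically P fun T => Subsingleton (T ⊗[MvPolynomial (Fin n) A] M) := by
  obtain ⟨g, hg, hgx⟩ := exists_notMem_smul_eq_zero (S := S) P
    (N := (⊤ : Submodule (MvPolynomial (Fin n) A) M)) Module.Finite.fg_top
      fun x hx => Subsingleton.elim _ _
  exact (generically_isUnit hg).imp fun T _ _ _ _ c _ hu =>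
    eq_zero_of_isUnit_smul hu fun x => hgx x trivial

include S in
theorem generically_surjective_of_localization {M N : Type} [AddCommGroup M]
    [Module (MvPolynomial (Fin n) A) M] [AddCommGroup N] [Module (MvPolynomial (Fin n) A) N]
    [Module.Finite (MvPolynomial (Fin n) A) N]
    (f : M →ₗ[MvPolynomial (Fin n) A] N) (hf : Function.Surjective (f.lTensor S)) :
    Generically P fun T => Function.Surjective (f.lTensor T) := by
  have hex (T : Type) [CommRing T] [Algebra (MvPolynomial (Fin n) A) T] :
      Function.Surjective (f.lTensor T) ↔
        Subsingleton (T ⊗[MvPolynomial (Fin n) A] (N ⧸ LinearMap.range f)) := by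
    have h2 := lTensor_exact T (LinearMap.exact_map_mkQ_range f) (Submodule.mkQ_surjective _)
    have h3 := LinearMap.lTensor_surjective T (LinearMap.range f).mkQ_surjective
    constructor
    · intro h
      refine subsingleton_of_forall_eq 0 fun z => ?_
      obtain ⟨w, rfl⟩ := h3 z
      obtain ⟨v, rfl⟩ := h w
      exact h2.apply_apply_eq_zero v
    · intro h z
      exact (h2 z).1 (Subsingleton.elim _ _)
  exact (generically_subsingleton_of_localization S ((hex S).1 hf)).imp
    fun T _ _ _ _ c _ hu => (hex T).2 hu

variable [IsLocalRing S]

theorem generically_gradeGE (M : Type) [AddCommGroup M]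
    [Module (MvPolynomial (Fin n) A) M] [Module.Finite (MvPolynomial (Fin n) A) M] :
    Generically P fun T => ∀ t,
      GradeGE (maximalIdeal T) (T ⊗[MvPolynomial (Fin n) A] M) t ↔
      GradeGE (maximalIdeal S) (S ⊗[MvPolynomial (Fin n) A] M) t := by
  suffices h : ∀ (N : Submodule (MvPolynomial (Fin n) A) M) (M' : Type) [AddCommGroup M']
      [Module (MvPolynomial (Fin n) A) M'] (q : M →ₗ[MvPolynomial (Fin n) A] M'),
      Function.Surjective q → LinearMap.ker q = N → Generically P fun T => ∀ t,
      GradeGE (maximalIdeal T) (T ⊗[MvPolynomial (Fin n) A] M') t ↔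
      GradeGE (maximalIdeal S) (S ⊗[MvPolynomial (Fin n) A] M') t from
    h _ M LinearMap.id Function.surjective_id rfl
  have : IsNoetherianRing S := IsLocalization.isNoetherianRing P.primeCompl S inferInstance
  intro N
  induction N using WellFoundedGT.induction with
  | ind N ih =>
  intro M' _ _ q hq hN
  have : Module.Finite (MvPolynomial (Fin n) A) M' := .of_surjective q hq
  rcases subsingleton_or_nontrivial (S ⊗[MvPolynomial (Fin n) A] M') with hS | hS
  · refine (generically_subsingleton_of_localization S hS).imp fun T _ _ _ _ c _ hT t => ?_
    exact ⟨fun h => absurd h.nontrivial (not_nontrivial_iff_subsingleton.2 hT),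
      fun h => absurd h.nontrivial (not_nontrivial_iff_subsingleton.2 hS)⟩
  by_cases hsoc : SocleFree S (S ⊗[MvPolynomial (Fin n) A] M')
  · obtain ⟨x, hx, hreg⟩ := hsoc.exists_isSMulRegular
    obtain ⟨b, s, rfl⟩ := IsLocalization.exists_mk'_eq P.primeCompl x
    have hbx : algebraMap (MvPolynomial (Fin n) A) S s * IsLocalization.mk' S b s =
      algebraMap _ S b := IsLocalization.mk'_spec' S b s
    have hbm : algebraMap (MvPolynomial (Fin n) A) S b ∈ maximalIdeal S :=
      hbx ▸ Ideal.mul_mem_left _ _ hx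
    have hbreg : IsSMulRegular (S ⊗[MvPolynomial (Fin n) A] M')
        (algebraMap (MvPolynomial (Fin n) A) S b) :=
      hbx ▸ (IsUnit.isSMulRegular _ (IsLocalization.map_units S s)).mul hreg
    have hbP : b ∈ P := (IsLocalization.AtPrime.to_map_mem_maximal_iff S P b).1 hbm
    have hlt : N < LinearMap.ker ((Submodule.mkQ (b • (⊤ : Submodule (MvPolynomial (Fin n) A) M'))) ∘ₗ q) := by
      refine lt_of_le_of_ne (hN ▸ fun y hy => ?_) fun heq => ?_
      · rw [LinearMap.mem_ker, LinearMap.comp_apply, LinearMap.mem_ker.1 hy, map_zero]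
      · have hb0 (y : M') : b • y = 0 := by
          obtain ⟨w, rfl⟩ := hq y
          rw [← map_smul, ← LinearMap.mem_ker, hN, heq, LinearMap.mem_ker, LinearMap.comp_apply,
            map_smul, Submodule.mkQ_apply, Submodule.Quotient.mk_eq_zero]
          exact mem_smul_top_iff_exists.2 ⟨_, rfl⟩
        obtain ⟨z, hz⟩ := exists_ne (0 : S ⊗[MvPolynomial (Fin n) A] M')
        refine hz (hbreg ?_)
        change algebraMap (MvPolynomial (Fin n) A) S b • z =
          algebraMap (MvPolynomial (Fin n) A) S b • 0
        rw [smul_zero, ← lTensor_lsmul, show LinearMap.lsmul _ M' b = 0 from LinearMap.ext hb0,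
          LinearMap.lTensor_zero, LinearMap.zero_apply]
    refine ((ih _ hlt (QuotSMulTop b M') _ ((Submodule.mkQ_surjective _).comp hq) rfl).and
      (generically_injective_of_localization S _ ((isSMulRegular_tensor_iff b).1 hbreg))).imp
      fun T _ _ _ _ c hT ⟨hiff, hinj⟩ t => ?_
    have hbT := hT.algebraMap_mem hbP
    have hregT := (isSMulRegular_tensor_iff (T := T) b).2 hinj
    have hiff' (t : ℕ) : GradeGE (maximalIdeal T)
        (QuotSMulTop (algebraMap (MvPolynomial (Fin n) A) T b) (T ⊗[MvPolynomial (Fin n) A] M')) t ↔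
      GradeGE (maximalIdeal S)
        (QuotSMulTop (algebraMap (MvPolynomial (Fin n) A) S b) (S ⊗[MvPolynomial (Fin n) A] M')) t := by
      rw [gradeGE_congr _ (QuotSMulTop.algebraMapTensorEquivTensorQuotSMulTop b M' T),
        gradeGE_congr _ (QuotSMulTop.algebraMapTensorEquivTensorQuotSMulTop b M' S)]
      exact hiff t
    cases t with
    | zero =>
      have := hiff' 0
      rwa [gradeGE_zero_iff, gradeGE_zero_iff, nontrivial_quotSMulTop_iff hbT,
        nontrivial_quotSMulTop_iff hbm, ← gradeGE_zero_iff (maximalIdeal T),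
        ← gradeGE_zero_iff (maximalIdeal S)] at this
    | succ t =>
      rw [gradeGE_succ_iff_quotSMulTop hbT hregT, gradeGE_succ_iff_quotSMulTop hbm hbreg]
      exact hiff' t
  · unfold SocleFree at hsoc
    push Not at hsoc
    obtain ⟨z, hz, hz0⟩ := hsoc
    obtain ⟨⟨m, s⟩, hms⟩ := IsLocalizedModule.surj P.primeCompl
      (TensorProduct.mk (MvPolynomial (Fin n) A) S M' 1) z
    have hms' : algebraMap (MvPolynomial (Fin n) A) S s • z = 1 ⊗ₜ m := by
      rw [algebraMap_smul]
      exact hms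
    have hu := IsLocalization.map_units S s
    have hm0 : (1 : S) ⊗ₜ[MvPolynomial (Fin n) A] m ≠ 0 := by
      rw [← hms', Ne, hu.smul_eq_zero]
      exact hz0
    have hmul (g : MvPolynomial (Fin n) A) : (1 : S) ⊗ₜ[MvPolynomial (Fin n) A] (g • m) =
        algebraMap (MvPolynomial (Fin n) A) S g • (1 ⊗ₜ m) := by
      rw [tmul_smul, algebraMap_smul]
    obtain ⟨g, hg, hgm⟩ := exists_notMem_smul_eq_zero (S := S) P
      (N := Submodule.map (LinearMap.toSpanSingleton (MvPolynomial (Fin n) A) M' m) P)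
      (Submodule.FG.map _ (IsNoetherian.noetherian P)) (by
        rintro _ ⟨b, hb, rfl⟩
        rw [LinearMap.toSpanSingleton_apply, hmul, ← hms', smul_comm,
          hz _ ((IsLocalization.AtPrime.to_map_mem_maximal_iff S P b).2 hb), smul_zero])
    let φ : (MvPolynomial (Fin n) A ⧸ P) →ₗ[MvPolynomial (Fin n) A] M' :=
      Submodule.liftQ P (LinearMap.toSpanSingleton _ M' (g • m)) fun b hb => by
        rw [LinearMap.mem_ker, LinearMap.toSpanSingleton_apply, smul_comm]
        exact hgm _ ⟨b, hb, rfl⟩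
    have hφ : Function.Injective φ := by
      rw [← LinearMap.ker_eq_bot]
      refine Submodule.ker_liftQ_eq_bot _ _ _ fun b hb => ?_
      by_contra hbP
      rw [LinearMap.mem_ker, LinearMap.toSpanSingleton_apply, smul_smul] at hb
      have h1 := hmul (b * g)
      rw [hb, tmul_zero] at h1
      exact hm0 (((IsLocalization.map_units S (⟨b * g, P.primeCompl.mul_mem hbP hg⟩ :
        P.primeCompl)).smul_eq_zero).1 h1.symm)
    refine (generically_injective P φ hφ).imp fun T _ _ _ _ c hT hinj t => ?_
    obtain ⟨y, hy0, hy⟩ := hT.exists_socle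
    have hTy0 : φ.lTensor T y ≠ 0 := fun h => hy0 (hinj (h.trans (map_zero _).symm))
    cases t with
    | zero =>
      rw [gradeGE_zero_iff, gradeGE_zero_iff]
      exact ⟨fun _ => hS, fun _ => ⟨_, _, hTy0⟩⟩
    | succ t =>
      refine ⟨fun h => absurd ?_ hTy0, fun h => absurd (h.socleFree z hz) hz0⟩
      refine h.socleFree _ fun a ha => ?_
      have := (φ.baseChange T).map_smul a y
      rw [hy a ha, map_zero] at this
      exact this.symm

end GenericDepth

section GenericProjectiveDimension

open TensorProduct IsLocalRing CategoryTheory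

theorem subsingleton_of_projective_of_range_le {T N F Q : Type} [CommRing T] [IsLocalRing T]
    [AddCommGroup N] [Module T N] [Module.Finite T N] [AddCommGroup F] [Module T F]
    [AddCommGroup Q] [Module T Q] [Module.Projective T Q] {i : N →ₗ[T] F} {p : F →ₗ[T] Q}
    (hi : Function.Injective i) (hip : Function.Exact i p) (hp : Function.Surjective p)
    (hle : LinearMap.range i ≤ maximalIdeal T • (⊤ : Submodule T F)) : Subsingleton N := by
  obtain ⟨s, hs⟩ := Module.projective_lifting_property p LinearMap.id hp
  obtain ⟨ρ, hρ⟩ := ((hip.split_tfae' ).out 0 1 rfl rfl).1 ⟨hi, s, hs⟩ |>.2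
  have h1 : (⊤ : Submodule T N) ≤ maximalIdeal T • ⊤ := by
    rintro z -
    have h2 : ρ (i z) ∈ Submodule.map ρ (maximalIdeal T • (⊤ : Submodule T F)) :=
      ⟨i z, hle ⟨z, rfl⟩, rfl⟩
    rw [Submodule.map_smul''] at h2
    rw [← LinearMap.comp_apply, hρ, LinearMap.id_apply] at h2
    exact Submodule.smul_mono le_rfl le_top h2
  have h2 := Submodule.eq_bot_of_le_smul_of_le_jacobson_bot _ _ Module.Finite.fg_top h1
    (maximalIdeal_le_jacobson _)
  exact (Submodule.subsingleton_iff T).1 (subsingleton_of_bot_eq_top h2.symm)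

/-- lifting a minimal generating set of a localization -/
theorem exists_linearMap_surjective_of_localization {B S M : Type} [CommRing B] [CommRing S]
    [Algebra B S] (P : Ideal B) [P.IsPrime] [IsLocalization.AtPrime S P] [AddCommGroup M]
    [Module B M] [Module.Finite B M] :
    ∃ (r : ℕ) (f : (Fin r → B) →ₗ[B] M), Function.Surjective (f.baseChange S) ∧
      ∀ x ∈ LinearMap.ker f, ∀ j, x j ∈ P := by
  classical
  let Φ (r : ℕ) : Prop := ∃ v : Fin r → M,
    Submodule.span S (Set.range fun j => (1 : S) ⊗ₜ[B] v j) = ⊤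
  have hex : ∃ r : ℕ, Φ r := by
    obtain ⟨r, v, hv⟩ := Module.Finite.exists_fin (R := B) (M := M)
    refine ⟨r, v, ?_⟩
    rw [eq_top_iff, ← Submodule.baseChange_top (A := S), ← hv, Submodule.baseChange_span,
      ← Set.range_comp]
    rfl
  obtain ⟨r, ⟨v, hv⟩, hmin⟩ : ∃ r, Φ r ∧ ∀ r' < r, ¬ Φ r' :=
    ⟨Nat.find hex, Nat.find_spec hex, fun _ => Nat.find_min hex⟩
  refine ⟨r, Fintype.linearCombination B v, ?_, fun x hx j => ?_⟩
  · rw [← LinearMap.range_eq_top, eq_top_iff, ← hv, Submodule.span_le]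
    rintro _ ⟨j, rfl⟩
    exact ⟨1 ⊗ₜ Pi.single j 1, by
      rw [LinearMap.baseChange_tmul, Fintype.linearCombination_apply_single, one_smul]⟩
  · by_contra hj
    obtain ⟨r, rfl⟩ : ∃ r', r = r' + 1 := Nat.exists_eq_add_one.2 j.pos
    refine hmin r (Nat.lt_succ_self r) ⟨v ∘ j.succAbove, eq_top_iff.2 ?_⟩
    rw [← hv, Submodule.span_le]
    rintro _ ⟨i, rfl⟩
    by_cases hij : i = j
    · have hu := IsLocalization.map_units S (⟨x j, hj⟩ : P.primeCompl)
      rw [hij, SetLike.mem_coe, ← Submodule.smul_mem_iff_of_isUnit _ hu]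
      rw [LinearMap.mem_ker, Fintype.linearCombination_apply, Fin.sum_univ_succAbove _ j] at hx
      have h0 := congrArg (fun y => (1 : S) ⊗ₜ[B] y) hx
      simp only [tmul_add, tmul_sum, tmul_zero, tmul_smul] at h0
      rw [algebraMap_smul, eq_neg_of_add_eq_zero_left h0]
      refine Submodule.neg_mem _ (Submodule.sum_mem _ fun l _ => ?_)
      rw [← algebraMap_smul S]
      exact Submodule.smul_mem _ _ (Submodule.subset_span ⟨l, rfl⟩)
    · obtain ⟨l, rfl⟩ := Fin.exists_succAbove_eq hij
      exact Submodule.subset_span ⟨l, rfl⟩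

theorem range_baseChange_le {B T : Type} [CommRing B] [CommRing T] [Algebra B T] {r : ℕ}
    (I : Ideal T) (N : Submodule B (Fin r → B)) (h : ∀ x ∈ N, ∀ j, algebraMap B T (x j) ∈ I) :
    LinearMap.range (N.subtype.baseChange T) ≤ I • (⊤ : Submodule T (T ⊗[B] (Fin r → B))) := by
  classical
  rintro _ ⟨z, rfl⟩
  induction z with
  | zero => rw [map_zero]; exact zero_mem _
  | add x y hx hy => rw [map_add]; exact add_mem hx hy
  | tmul t x =>
    rw [LinearMap.baseChange_tmul, Submodule.subtype_apply,
      ← Finset.univ_sum_single (x : Fin r → B), tmul_sum]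
    refine Submodule.sum_mem _ fun j _ => ?_
    have : t ⊗ₜ[B] (Pi.single j ((x : Fin r → B) j) : Fin r → B) =
        algebraMap B T ((x : Fin r → B) j) • (t ⊗ₜ Pi.single j 1) := by
      rw [algebraMap_smul, ← tmul_smul, ← Pi.single_smul, smul_eq_mul, mul_one]
    rw [this]
    exact Submodule.smul_mem_smul (h x x.2 j) trivial

variable {A : Type} [CommRing A] [IsDomain A] [IsNoetherianRing A] {n : ℕ}
  {P : Ideal (MvPolynomial (Fin n) A)} [P.IsPrime]
  (S : Type) [CommRing S] [Algebra (MvPolynomial (Fin n) A) S] [IsLocalization.AtPrime S P]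

theorem generically_projective [IsLocalRing S] (M : Type) [AddCommGroup M]
    [Module (MvPolynomial (Fin n) A) M] [Module.Finite (MvPolynomial (Fin n) A) M] :
    Generically P fun T => Module.Projective T (T ⊗[MvPolynomial (Fin n) A] M) ↔
      Module.Projective S (S ⊗[MvPolynomial (Fin n) A] M) := by
  obtain ⟨r, f, hf, hfP⟩ := exists_linearMap_surjective_of_localization (S := S) (M := M) P
  have hex (T : Type) [CommRing T] [Algebra (MvPolynomial (Fin n) A) T]
      (h : Function.Injective ((LinearMap.range f).subtype.lTensor T)) :
      Function.Exact ((LinearMap.ker f).subtype.baseChange T) (f.baseChange T) := by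
    have h1 := lTensor_exact T (f := (LinearMap.ker f).subtype) (g := f.rangeRestrict)
      (exact_subtype_ker_rangeRestrict f) f.surjective_rangeRestrict
    intro z
    refine Iff.trans ?_ (h1 z)
    rw [← map_eq_zero_iff _ h, ← LinearMap.comp_apply, ← LinearMap.lTensor_comp]
    rfl
  have : Module.Flat (MvPolynomial (Fin n) A) S := IsLocalization.flat S P.primeCompl
  have hflat (N : Submodule (MvPolynomial (Fin n) A) M) :
      Function.Injective (N.subtype.lTensor S) :=
    Module.Flat.lTensor_preserves_injective_linearMap _ N.subtype_injective
  have hrange := generically_injective P (LinearMap.range f).subtype (Submodule.subtype_injective _)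
  have hsurj := hrange.and (generically_surjective_of_localization S f hf)
  by_cases hS : Subsingleton (S ⊗[MvPolynomial (Fin n) A] LinearMap.ker f)
  · have hiff (T : Type) [CommRing T] [Algebra (MvPolynomial (Fin n) A) T]
        (h : Function.Surjective (f.baseChange T))
        (hr : Function.Injective ((LinearMap.range f).subtype.lTensor T))
        (h0 : Subsingleton (T ⊗[MvPolynomial (Fin n) A] LinearMap.ker f)) :
        Module.Projective T (T ⊗[MvPolynomial (Fin n) A] M) := by
      refine Module.Projective.of_equiv (LinearEquiv.ofBijective (f.baseChange T) ⟨?_, h⟩)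
      rw [injective_iff_map_eq_zero]
      intro z hz
      obtain ⟨w, rfl⟩ := (hex T hr z).1 hz
      rw [Subsingleton.elim w 0, map_zero]
    exact (hsurj.and
      (generically_subsingleton_of_localization S hS)).imp fun T _ _ _ _ c _ ⟨⟨hr, h⟩, h0⟩ =>
        ⟨fun _ => hiff S hf (hflat _) hS, fun _ => hiff T h hr h0⟩
  · have hiff (T : Type) [CommRing T] [Algebra (MvPolynomial (Fin n) A) T] [IsLocalRing T]
        (h : Function.Surjective (f.baseChange T))
        (hr : Function.Injective ((LinearMap.range f).subtype.lTensor T))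
        (hi : Function.Injective ((LinearMap.ker f).subtype.baseChange T))
        (hP : ∀ b ∈ P, algebraMap (MvPolynomial (Fin n) A) T b ∈ maximalIdeal T)
        (h0 : ¬ Subsingleton (T ⊗[MvPolynomial (Fin n) A] LinearMap.ker f)) :
        ¬ Module.Projective T (T ⊗[MvPolynomial (Fin n) A] M) := fun hp =>
      h0 (subsingleton_of_projective_of_range_le hi (hex T hr) h
        (range_baseChange_le _ _ fun x hx j => hP _ (hfP x hx j)))
    refine ((hsurj.and
      (generically_injective P (LinearMap.ker f).subtype (Submodule.subtype_injective _))).and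
      (generically_gradeGE (P := P) S (LinearMap.ker f))).imp
      fun T _ _ _ _ c hT ⟨⟨⟨hr, h⟩, hi⟩, h0⟩ => ?_
    have h1 := h0 0
    rw [gradeGE_zero_iff, gradeGE_zero_iff, ← not_subsingleton_iff_nontrivial,
      ← not_subsingleton_iff_nontrivial] at h1
    exact iff_of_false (hiff T h hr hi (fun b hb => hT.algebraMap_mem hb) (h1.2 hS))
      (hiff S hf (hflat _)
        (Module.Flat.lTensor_preserves_injective_linearMap _ (Submodule.subtype_injective _))
        (fun b hb => (IsLocalization.AtPrime.to_map_mem_maximal_iff S P b).2 hb) hS)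

theorem generically_hasProjectiveDimensionLE [IsLocalRing S] (d : ℕ) (M : Type) [AddCommGroup M]
    [Module (MvPolynomial (Fin n) A) M] [Module.Finite (MvPolynomial (Fin n) A) M] :
    Generically P fun T =>
      HasProjectiveDimensionLE (ModuleCat.of T (T ⊗[MvPolynomial (Fin n) A] M)) d ↔
      HasProjectiveDimensionLE (ModuleCat.of S (S ⊗[MvPolynomial (Fin n) A] M)) d := by
  induction d generalizing M with
  | zero =>
    simp only [hasProjectiveDimensionLE_zero_iff]
    exact generically_projective S M
  | succ d ih =>
    obtain ⟨r, f, hf⟩ := Module.Finite.exists_fin' (MvPolynomial (Fin n) A) M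
    have : Module.Flat (MvPolynomial (Fin n) A) S := IsLocalization.flat S P.primeCompl
    have hiff (T : Type) [CommRing T] [Algebra (MvPolynomial (Fin n) A) T]
        (hi : Function.Injective ((LinearMap.ker f).subtype.baseChange T)) :=
      hasProjectiveDimensionLE_succ_iff _ (f.baseChange T) hi
        (lTensor_exact T (f.exact_subtype_ker_map) hf) (LinearMap.lTensor_surjective T hf) d
    refine ((ih (LinearMap.ker f)).and (generically_injective P (LinearMap.ker f).subtype
      (Submodule.subtype_injective _))).imp fun T _ _ _ _ c hT ⟨h, hi⟩ => ?_
    rw [hiff T hi, hiff S (Module.Flat.lTensor_preserves_injective_linearMap _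
      (Submodule.subtype_injective _)), h]

end GenericProjectiveDimension

section Assembly

open TensorProduct IsLocalRing CategoryTheory

attribute [local instance] MvPolynomial.algebraMvPolynomial

theorem projDim_congr {T N N' : Type} [CommRing T] [IsLocalRing T] [IsNoetherianRing T]
    [AddCommGroup N] [Module T N] [Module.Finite T N] [AddCommGroup N'] [Module T N']
    [Module.Finite T N'] (e : N ≃ₗ[T] N') : projDim T N = projDim T N' := by
  simp only [projDim, projDimLE_iff, hasProjectiveDimensionLE_congr e]

theorem depth_congr {T N N' : Type} [CommRing T] [IsLocalRing T]
    [AddCommGroup N] [Module T N] [AddCommGroup N'] [Module T N'] (e : N ≃ₗ[T] N') :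
    depth T N = depth T N' := by
  simp only [depth, grade, gradeGE_congr _ e]

theorem projDim_eq_of_forall_le {T T' N N' : Type} [CommRing T] [CommRing T'] [AddCommGroup N]
    [Module T N] [AddCommGroup N'] [Module T' N'] {e : ℕ} (he : ProjDimLE T N e)
    (h : ∀ d ≤ e, ProjDimLE T N d ↔ ProjDimLE T' N' d) : projDim T N = projDim T' N' := by
  have h1 (d : ℕ) : ProjDimLE T N d ↔ ProjDimLE T' N' d := by
    rcases le_total d e with hd | hd
    · exact h d hd
    · exact iff_of_true (he.mono hd) (((h e le_rfl).1 he).mono hd)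
  simp only [projDim, h1]

theorem generically_projDim_depth {A : Type} [CommRing A] [IsDomain A] [IsNoetherianRing A] {n : ℕ}
    {P : Ideal (MvPolynomial (Fin n) A)} [P.IsPrime] (S : Type) [CommRing S] [IsLocalRing S]
    [Algebra (MvPolynomial (Fin n) A) S] [IsLocalization.AtPrime S P] {e : ℕ}
    (hS : GlobalDimLE S e) (M : Type) [AddCommGroup M] [Module (MvPolynomial (Fin n) A) M]
    [Module.Finite (MvPolynomial (Fin n) A) M] :
    Generically P fun T =>
      projDim T (T ⊗[MvPolynomial (Fin n) A] M) = projDim S (S ⊗[MvPolynomial (Fin n) A] M) ∧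
      depth T (T ⊗[MvPolynomial (Fin n) A] M) = depth S (S ⊗[MvPolynomial (Fin n) A] M) := by
  have : IsNoetherianRing S := IsLocalization.isNoetherianRing P.primeCompl S inferInstance
  have h1 (e : ℕ) : Generically P fun T => ∀ d ≤ e,
      HasProjectiveDimensionLE (ModuleCat.of T (T ⊗[MvPolynomial (Fin n) A] M)) d ↔
      HasProjectiveDimensionLE (ModuleCat.of S (S ⊗[MvPolynomial (Fin n) A] M)) d := by
    induction e with
    | zero =>
      exact (generically_hasProjectiveDimensionLE S 0 M).imp fun T _ _ _ _ c _ h d hd => by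
        rwa [Nat.le_zero.1 hd]
    | succ e ih =>
      refine (ih.and (generically_hasProjectiveDimensionLE S (e + 1) M)).imp
        fun T _ _ _ _ c _ ⟨h, h'⟩ d hd => ?_
      rcases Nat.le_succ_iff.1 hd with hd | rfl
      · exact h d hd
      · exact h'
  refine ((h1 e).and (generically_gradeGE S M)).imp fun T _ _ _ _ c _ ⟨h, h'⟩ => ⟨?_, ?_⟩
  · exact (projDim_eq_of_forall_le (projDimLE_iff.2 (hS _)) fun d hd => by
      rw [projDimLE_iff, projDimLE_iff, h d hd]).symm
  · simp only [depth, grade, h']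

theorem exact_mulVecLin_baseChange {B T : Type} [CommRing B] [CommRing T] [Algebra B T] {r s : ℕ}
    (b : Matrix (Fin r) (Fin s) B) :
    ∃ g : (Fin r → T) →ₗ[T] T ⊗[B] MatCoker b, Function.Surjective g ∧
      Function.Exact (b.map (algebraMap B T)).mulVecLin g := by
  let e (t : ℕ) : (T ⊗[B] (Fin t → B)) ≃ₗ[T] (Fin t → T) := TensorProduct.piScalarRight B T T (Fin t)
  have he (z : T ⊗[B] (Fin s → B)) : (b.map (algebraMap B T)).mulVecLin (e s z) =
      e r (b.mulVecLin.baseChange T z) := by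
    induction z with
    | zero => simp
    | add x y hx hy => rw [map_add, map_add, hx, hy, map_add, map_add]
    | tmul t x =>
      ext i
      simp [e, Matrix.mulVec, dotProduct, Algebra.smul_def, Finset.sum_mul, mul_assoc]
  refine ⟨(LinearMap.range b.mulVecLin).mkQ.baseChange T ∘ₗ (e r).symm,
    (LinearMap.lTensor_surjective T (Submodule.mkQ_surjective _)).comp (e r).symm.surjective, ?_⟩
  intro x
  have h := lTensor_exact T (LinearMap.exact_map_mkQ_range b.mulVecLin)
    (Submodule.mkQ_surjective _) ((e r).symm x)
  refine h.trans ⟨?_, ?_⟩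
  · rintro ⟨z, hz⟩
    exact ⟨e s z, by rw [he]; exact (congrArg (e r) hz).trans ((e r).apply_symm_apply x)⟩
  · rintro ⟨y, rfl⟩
    refine ⟨(e s).symm y, (e r).injective ((he _).symm.trans ?_)⟩
    rw [LinearEquiv.apply_symm_apply, LinearEquiv.apply_symm_apply]

theorem nonempty_matCoker_equiv {B T : Type} [CommRing B] [CommRing T] [Algebra B T] {r s : ℕ}
    (b : Matrix (Fin r) (Fin s) B) (C : Matrix (Fin r) (Fin s) T) {a : B}
    (ha : IsUnit (algebraMap B T a))
    (h : ∀ i j, algebraMap B T a * C i j = algebraMap B T (b i j)) :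
    Nonempty (MatCoker C ≃ₗ[T] T ⊗[B] MatCoker b) := by
  obtain ⟨g, hg, hex⟩ := exact_mulVecLin_baseChange (T := T) b
  have hmap : b.map (algebraMap B T) = algebraMap B T a • C := by
    ext i j
    exact (h i j).symm
  have hrange : LinearMap.range C.mulVecLin = LinearMap.range (b.map (algebraMap B T)).mulVecLin := by
    rw [hmap]
    obtain ⟨u, hu⟩ := ha
    ext x
    constructor
    · rintro ⟨y, rfl⟩
      refine ⟨(↑u⁻¹ : T) • y, ?_⟩
      rw [Matrix.mulVecLin_apply, Matrix.smul_mulVec, Matrix.mulVec_smul, ← hu, smul_smul,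
        Units.mul_inv, one_smul, Matrix.mulVecLin_apply]
    · rintro ⟨y, rfl⟩
      refine ⟨algebraMap B T a • y, ?_⟩
      rw [Matrix.mulVecLin_apply, Matrix.mulVecLin_apply, Matrix.mulVec_smul, Matrix.smul_mulVec]
  exact ⟨(Submodule.quotEquivOfEq _ _ (hrange.trans hex.linearMap_ker_eq.symm)).trans
    (g.quotKerEquivOfSurjective hg)⟩

theorem eval_map_eq_evalα {k K : Type} [Field k] [Field K] [Algebra k K] {m : ℕ} (α : Fin m → K)
    (c : MvPolynomial (Fin m) k) :
    MvPolynomial.eval α (MvPolynomial.map (algebraMap k K) c) = (evalα k K α c : K) := by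
  induction c using MvPolynomial.induction_on with
  | C a =>
    rw [map_C, eval_C, evalα, AlgHom.toRingHom_eq_coe, RingHom.coe_coe, aeval_C]
    rfl
  | add p q hp hq => rw [map_add, map_add, map_add, hp, hq, IntermediateField.coe_add]
  | mul_X p i hp =>
    rw [map_mul, map_mul, map_mul, hp, IntermediateField.coe_mul, map_X, eval_X, evalα,
      AlgHom.toRingHom_eq_coe, RingHom.coe_coe, aeval_X]

theorem toR_injective (k : Type) [Field k] (m n : ℕ) : Function.Injective (toR k m n) :=
  MvPolynomial.map_injective _ (IsFractionRing.injective _ _)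

/-- specialization of elements of local rings respects denominators -/
theorem LocElemSpec.mul_eq {k K : Type} [Field k] [Field K] [Algebra k K] {m n : ℕ}
    {α : Fin m → K} {P : Ideal (Rg k m n)} [P.IsPrime] {℘ : Ideal (Ra k K n α)} [℘.IsPrime]
    {S : Type} [CommRing S] [Algebra (Rg k m n) S] [IsLocalization.AtPrime S P]
    {Sα : Type} [CommRing Sα] [Algebra (Ra k K n α) Sα] [IsLocalization.AtPrime Sα ℘]
    {a : S} {aα : Sα} (h : LocElemSpec P ℘ a aα)
    {s b : MvPolynomial (Fin n) (MvPolynomial (Fin m) k)}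
    (hsb : algebraMap (Rg k m n) S (toR k m n s) * a = algebraMap (Rg k m n) S (toR k m n b)) :
    algebraMap (Ra k K n α) Sα (toRa k K n α s) * aα =
      algebraMap (Ra k K n α) Sα (toRa k K n α b) := by
  obtain ⟨f, g, fα, gα, hg, hgα, ⟨p, q, hq, hf, hfα⟩, ⟨p', q', hq', hg', hgα'⟩, rfl, rfl⟩ := h
  have h1 : toR k m n s * f = toR k m n b * g := by
    refine IsLocalization.injective S P.primeCompl_le_nonZeroDivisors ?_
    rw [map_mul, map_mul, ← hsb, mul_assoc]
    congr 1
    exact (IsLocalization.mk'_spec S f ⟨g, hg⟩).symm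
  have hC (q : MvPolynomial (Fin m) k) :
      toR k m n (C q) = C (algebraMap (MvPolynomial (Fin m) k) (kU k m) q) := map_C _ _
  have hCα (q : MvPolynomial (Fin m) k) : toRa k K n α (C q) = C (evalα k K α q) := map_C _ _
  have h2 : s * C q' * p = b * C q * p' := by
    refine toR_injective k m n ?_
    simp only [map_mul, ← hf, ← hg', hC]
    linear_combination (C (algebraMap (MvPolynomial (Fin m) k) (kU k m) q) *
      C (algebraMap (MvPolynomial (Fin m) k) (kU k m) q')) * h1
  have h3 : toRa k K n α s * fα = toRa k K n α b * gα := by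
    have h4 := congrArg (toRa k K n α) h2
    simp only [map_mul, ← hfα, ← hgα', hCα] at h4
    have h5 : (C (evalα k K α q) * C (evalα k K α q') : Ra k K n α) ≠ 0 :=
      mul_ne_zero (C_ne_zero.2 hq) (C_ne_zero.2 hq')
    refine mul_left_cancel₀ h5 ?_
    linear_combination h4
  have h6 := IsLocalization.mk'_spec Sα fα ⟨gα, hgα⟩
  have h7 := congrArg (algebraMap (Ra k K n α) Sα) h3
  simp only [map_mul] at h7
  refine (IsLocalization.map_units Sα (⟨gα, hgα⟩ : ℘.primeCompl)).mul_right_cancel ?_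
  rw [mul_assoc, h6, h7]

theorem isLocalization_atPrime_comap_toR {k : Type} [Field k] {m n : ℕ} (P : Ideal (Rg k m n))
    [P.IsPrime] (S : Type) [CommRing S] [Algebra (Rg k m n) S] [IsLocalization.AtPrime S P]
    [Algebra (MvPolynomial (Fin n) (MvPolynomial (Fin m) k)) S]
    [IsScalarTower (MvPolynomial (Fin n) (MvPolynomial (Fin m) k)) (Rg k m n) S] :
    IsLocalization.AtPrime S (P.comap (toR k m n)) := by
  have := MvPolynomial.isLocalization (σ := Fin n) (nonZeroDivisors (MvPolynomial (Fin m) k)) (kU k m)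
  exact IsLocalization.isLocalization_isLocalization_atPrime_isLocalization
    ((nonZeroDivisors (MvPolynomial (Fin m) k)).map
      (C : MvPolynomial (Fin m) k →+* MvPolynomial (Fin n) (MvPolynomial (Fin m) k))) S P

theorem exists_matrix_clearing_denominators {B S : Type} [CommRing B] [CommRing S] [Algebra B S]
    (W : Submonoid B) [IsLocalization W S] {r s : ℕ} (C : Matrix (Fin r) (Fin s) S) :
    ∃ a ∈ W, ∃ b : Matrix (Fin r) (Fin s) B,
      ∀ i j, algebraMap B S a * C i j = algebraMap B S (b i j) := by
  obtain ⟨a, ha⟩ := IsLocalization.exist_integer_multiples_of_finite W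
    fun x : Fin r × Fin s => C x.1 x.2
  choose b hb using ha
  exact ⟨a, a.2, fun i j => b (i, j), fun i j => by
    rw [hb (i, j), Algebra.smul_def]⟩

end Assembly

/-- for a finitely generated `S`-module `L`, for almost all `α`:
(i) `proj dim L_α = proj dim L`, and (ii) `depth L_α = depth L` (depth with
respect to the maximal ideals of the local rings `S_α` and `S`). -/
theorem specialization_preserves_projdim_and_depth
    (k K : Type) [Field k] [Field K] [Algebra k K] [Infinite K] {m n : ℕ}
    (P : Ideal (Rg k m n)) [P.IsPrime]
    (S : Type) [CommRing S] [Algebra (Rg k m n) S] [IsLocalization.AtPrime S P]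
    (L : Type) [AddCommGroup L] [Module S L] [Module.Finite S L]
    {rL sL : ℕ} (pL : Present S rL sL L) :
    haveI : IsLocalRing S := IsLocalization.AtPrime.isLocalRing S P
    AlmostAll K m fun α =>
      ∀ (℘ : Ideal (Ra k K n α))
        (h℘ : IsAssociatedPrime ℘ ((Ra k K n α) ⧸ idealSpec k K n α P)),
        haveI := h℘.isPrime
        ∀ (Sα : Type) [CommRing Sα] [Algebra (Ra k K n α) Sα]
          [IsLocalization.AtPrime Sα ℘],
          haveI : IsLocalRing Sα := IsLocalization.AtPrime.isLocalRing Sα ℘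
          ∀ B : Matrix (Fin rL) (Fin sL) Sα,
          MatSpec (LocElemSpec P ℘) pL.A B →
          projDim Sα (MatCoker B) = projDim S L ∧
          depth Sα (MatCoker B) = depth S L := by
  have : IsLocalRing S := IsLocalization.AtPrime.isLocalRing S P
  have : IsNoetherianRing S := IsLocalization.isNoetherianRing P.primeCompl S inferInstance
  let _ : Algebra (MvPolynomial (Fin n) (MvPolynomial (Fin m) k)) (Rg k m n) :=
    MvPolynomial.algebraMvPolynomial
  let _ : Algebra (MvPolynomial (Fin n) (MvPolynomial (Fin m) k)) S :=
    ((algebraMap (Rg k m n) S).comp (toR k m n)).toAlgebra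
  have : IsScalarTower (MvPolynomial (Fin n) (MvPolynomial (Fin m) k)) (Rg k m n) S :=
    IsScalarTower.of_algebraMap_eq' rfl
  have := isLocalization_atPrime_comap_toR P S
  obtain ⟨a, ha, b, hab⟩ :=
    exists_matrix_clearing_denominators (P.comap (toR k m n)).primeCompl pL.A
  have hgl : GlobalDimLE S n := (globalDimLE_mvPolynomial (kU k m) n).of_isLocalization P.primeCompl
  obtain ⟨c, hc, hgen⟩ := (generically_projDim_depth S hgl (MatCoker b)).and (generically_isUnit ha)
  refine ⟨MvPolynomial.map (algebraMap k K) c, ?_, ?_⟩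
  · rwa [Ne, map_eq_zero_iff _ (MvPolynomial.map_injective _ (algebraMap k K).injective)]
  intro α hα ℘ h℘ Sα _ _ _ D hD
  have : ℘.IsPrime := h℘.isPrime
  have : IsLocalRing Sα := IsLocalization.AtPrime.isLocalRing Sα ℘
  have : IsNoetherianRing Sα := IsLocalization.isNoetherianRing ℘.primeCompl Sα inferInstance
  let _ : Algebra (MvPolynomial (Fin m) k) (kA k K α) := (evalα k K α).toAlgebra
  let _ : Algebra (MvPolynomial (Fin n) (MvPolynomial (Fin m) k)) (Ra k K n α) :=
    MvPolynomial.algebraMvPolynomial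
  let _ : Algebra (MvPolynomial (Fin n) (MvPolynomial (Fin m) k)) Sα :=
    ((algebraMap (Ra k K n α) Sα).comp (toRa k K n α)).toAlgebra
  have : IsScalarTower (MvPolynomial (Fin n) (MvPolynomial (Fin m) k)) (Ra k K n α) Sα :=
    IsScalarTower.of_algebraMap_eq' rfl
  have hcα : evalα k K α c ≠ 0 := fun h => hα (by
    rw [eval_map_eq_evalα, h, ZeroMemClass.coe_zero])
  obtain ⟨⟨hpd, hdepth⟩, hu⟩ := hgen Sα ⟨kA k K α, inferInstance, inferInstance, inferInstance, ℘,
    inferInstance, hcα, this, h℘, inferInstance⟩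
  obtain ⟨e⟩ := nonempty_matCoker_equiv b pL.A
    (IsLocalization.map_units S (⟨a, ha⟩ : (P.comap (toR k m n)).primeCompl)) hab
  obtain ⟨eα⟩ := nonempty_matCoker_equiv b D hu fun i j => (hD i j).mul_eq (hab i j)
  let eL : L ≃ₗ[S] TensorProduct _ S (MatCoker b) :=
    ((Submodule.quotEquivOfEq _ _ pL.ker_eq).symm.trans
      (pL.π.quotKerEquivOfSurjective pL.surj)).symm.trans e
  exact ⟨(projDim_congr eα).trans (hpd.trans (projDim_congr eL).symm),
    (depth_congr eα).trans (hdepth.trans (depth_congr eL).symm)⟩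

end Spl
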